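/- arXiv:1701.02076 — 3 statements merged into one kernel-verified Lean document; each statement's English description precedes it below -/
import Mathlib

section
/- Let k be a commutative unital ring and q = (q_i)_{i ∈ I} ∈ k^I with q_i = q_j whenever m_{ij} is odd. Then the assignment T_i ↦ (class of s_i + (1 − q_i)·D_i) ⊗ 1 defines an injective homomorphism of k-algebras φ : H_q(W) → H̲(W) ⊗_ℤ k. -/
open scoped TensorProduct

namespace HeckeHopfCox

/-- Generators of `Ĥ(W)`: `s i` and `D i` for `i ∈ I`. -/
inductive Gen (B : Type*) : Type _
  | s : B → Gen B
  | D : B → Gen B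

/-- The free `ℤ`-algebra on the generators. -/
abbrev F (B : Type*) : Type _ := FreeAlgebra ℤ (Gen B)

noncomputable def fs {B : Type*} (i : B) : F B := FreeAlgebra.ι ℤ (Gen.s i)
noncomputable def fD {B : Type*} (i : B) : F B := FreeAlgebra.ι ℤ (Gen.D i)

/-- The alternating word `sᵢ sⱼ sᵢ ⋯` with `k` factors, starting with `sᵢ`. -/
noncomputable def altS {B : Type*} (i j : B) : ℕ → F B
  | 0 => 1
  | k + 1 => fs i * altS j i k

/-- The defining relations of `Ĥ(W)`: (i) rank-one relations; (ii) Coxeter relations;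
(iii) the linear braid relations `Dᵢ·(sⱼsᵢ⋯s_{j'}) = (sⱼ⋯s_{i'}s_{j'})·D_{i'}`, where the
alternating word has `m_{ij} - 1` factors starting with `sⱼ`, and `i' = i` if `m_{ij}` is
even and `i' = j` if `m_{ij}` is odd. -/
inductive Rel {B : Type*} (M : CoxeterMatrix B) : F B → F B → Prop
  | s_sq (i : B) : Rel M (fs i * fs i) 1
  | D_sq (i : B) : Rel M (fD i * fD i) (fD i)
  | sD (i : B) : Rel M (fs i * fD i + fD i * fs i) (fs i - 1)
  | coxeter (i j : B) : Rel M ((fs i * fs j) ^ M i j) 1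
  | braidLin (i j : B) : i ≠ j → M i j ≠ 0 →
      Rel M (fD i * altS j i (M i j - 1))
        (altS j i (M i j - 1) * fD (if M i j % 2 = 0 then i else j))

/-- The algebra `Ĥ(W)` associated to a Coxeter matrix. -/
abbrev HW {B : Type*} (M : CoxeterMatrix B) : Type _ := RingQuot (Rel M)

/-- The image of the generator `sᵢ` in `Ĥ(W)`. -/
noncomputable def hs {B : Type*} (M : CoxeterMatrix B) (i : B) : HW M :=
  RingQuot.mkAlgHom ℤ (Rel M) (fs i)

/-- The image of the generator `Dᵢ` in `Ĥ(W)`. -/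
noncomputable def hD {B : Type*} (M : CoxeterMatrix B) (i : B) : HW M :=
  RingQuot.mkAlgHom ℤ (Rel M) (fD i)

/-- The set of reflections of the Coxeter group `W`, as a subtype. -/
abbrev Refl {B : Type*} (M : CoxeterMatrix B) : Type _ :=
  {t : M.Group // M.toCoxeterSystem.IsReflection t}

/-- `K(W) = ⋂_w π(w)·D̂(W)·π(w)⁻¹`, where `D̂(W)` is the subalgebra generated by the
family `(D_s)_{s ∈ 𝒮}`. -/
def KW {B : Type*} (M : CoxeterMatrix B) (π : M.Group →* (HW M)ˣ)
    (Dfam : Refl M → HW M) : Set (HW M) :=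
  {x | ∀ w : M.Group,
    ((π w : (HW M)ˣ) : HW M) * x * (((π w)⁻¹ : (HW M)ˣ) : HW M) ∈
      Algebra.adjoin ℤ (Set.range Dfam)}

/-- The relation presenting the quotient of `Ĥ(W)` by the two-sided ideal generated by
`K(W) ∩ ker ε`; its `RingQuot` is the lower Hecke-Hopf algebra `H̲(W)`. -/
def lowRel {B : Type*} (M : CoxeterMatrix B) (π : M.Group →* (HW M)ˣ)
    (Dfam : Refl M → HW M) (ε : HW M →ₐ[ℤ] ℤ) : HW M → HW M → Prop :=
  fun x y => x ∈ KW M π Dfam ∧ ε x = 0 ∧ y = 0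

/-- The lower Hecke-Hopf algebra `H̲(W) = Ĥ(W)/J(W)`. -/
abbrev HWlow {B : Type*} (M : CoxeterMatrix B) (π : M.Group →* (HW M)ˣ)
    (Dfam : Refl M → HW M) (ε : HW M →ₐ[ℤ] ℤ) : Type _ :=
  RingQuot (lowRel M π Dfam ε)

section Hecke

variable {B : Type*} (k : Type*) [CommRing k]

noncomputable def fT (i : B) : FreeAlgebra k B := FreeAlgebra.ι k i

/-- The alternating product `Tᵢ Tⱼ Tᵢ ⋯` with `m` factors, starting with `Tᵢ`. -/
noncomputable def altT (i j : B) : ℕ → FreeAlgebra k B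
  | 0 => 1
  | m + 1 => fT k i * altT j i m

/-- The defining relations of the generalized Hecke algebra `H_q(W)`:
`Tᵢ² = (1 - qᵢ)Tᵢ + qᵢ` and the braid relations. -/
inductive HqRel (M : CoxeterMatrix B) (q : B → k) :
    FreeAlgebra k B → FreeAlgebra k B → Prop
  | quad (i : B) : HqRel M q (fT k i * fT k i)
      (algebraMap k (FreeAlgebra k B) (1 - q i) * fT k i + algebraMap k (FreeAlgebra k B) (q i))
  | braid (i j : B) : i ≠ j → M i j ≠ 0 →
      HqRel M q (altT k i j (M i j)) (altT k j i (M i j))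

/-- The generalized Hecke algebra `H_q(W)`. -/
abbrev HqW (M : CoxeterMatrix B) (q : B → k) : Type _ := RingQuot (HqRel k M q)

/-- The image of the generator `Tᵢ` in `H_q(W)`. -/
noncomputable def tW (M : CoxeterMatrix B) (q : B → k) (i : B) : HqW k M q :=
  RingQuot.mkAlgHom k (HqRel k M q) (fT k i)

end Hecke

section Coxeter

open Real Polynomial.Chebyshev

variable {B W : Type*} [Group W] {M : CoxeterMatrix B} (cs : CoxeterSystem M W)

/-- The coroot of the geometric representation attached to `i`. -/
noncomputable def coroot (M : CoxeterMatrix B) (i : B) : Module.Dual ℝ (B →₀ ℝ) :=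
  Finsupp.linearCombination ℝ fun j => -2 * cos (π / M i j)

lemma coroot_single (i j : B) :
    coroot M i (Finsupp.single j 1) = -2 * cos (π / M i j) := by
  simp [coroot]

lemma coroot_self (i : B) : coroot M i (Finsupp.single i 1) = 2 := by
  simp [coroot_single]

lemma coroot_mul_coroot_sub_two (i j : B) :
    coroot M i (Finsupp.single j 1) * coroot M j (Finsupp.single i 1) - 2 =
      2 * cos (2 * π / M i j) := by
  rw [coroot_single, coroot_single, M.symmetric j i,
    show 2 * π / (M i j : ℝ) = 2 * (π / M i j) by ring, cos_two_mul]
  ring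

lemma sin_two_pi_div_pos {m : ℕ} (hm : 3 ≤ m) : 0 < sin (2 * π / m) := by
  have hm' : (3 : ℝ) ≤ m := by exact_mod_cast hm
  have := pi_pos
  apply sin_pos_of_pos_of_lt_pi
  · positivity
  · rw [div_lt_iff₀ (by linarith)]
    nlinarith

lemma isLiftable_reflection (M : CoxeterMatrix B) :
    M.IsLiftable fun i => Module.reflection (coroot_self (M := M) i) := by
  intro i j
  have hij := Module.reflection_mul_reflection_pow (coroot_self (M := M) i)
    (coroot_self (M := M) j) (M i j)
  rw [coroot_mul_coroot_sub_two] at hij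
  apply LinearEquiv.toLinearMap_injective
  by_cases h0 : M i j = 0
  · simp [h0]
  by_cases h1 : M i j = 1
  · have : i = j := by
      by_contra h
      exact M.off_diagonal i j h h1
    subst this
    rw [h1, pow_one]
    exact LinearMap.ext fun x => Module.involutive_reflection (coroot_self (M := M) i) x
  by_cases h2 : M i j = 2
  · have e1 : coroot M i (Finsupp.single j 1) = 0 := by simp [coroot_single, h2]
    have e2 : coroot M j (Finsupp.single i 1) = 0 := by simp [coroot_single, M.symmetric j i, h2]
    rw [h2] at hij ⊢
    rw [hij]
    refine LinearMap.ext fun x => ?_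
    simp [e1, e2]
    module
  have h3 : 3 ≤ M i j := by omega
  rw [hij]
  have hs := sin_two_pi_div_pos h3
  generalize M i j = m at *
  have hm : (m : ℝ) ≠ 0 := by positivity
  have key : ∀ n : ℤ, (S ℝ n).eval (2 * cos (2 * π / m)) =
      sin ((n + 1) * (2 * π / m)) / sin (2 * π / m) := fun n => by
    rw [eq_div_iff hs.ne', S_two_mul_real_cos]
  rcases Nat.even_or_odd' m with ⟨k, hk | hk⟩
  · have a1 : ((m : ℤ) - 2) / 2 = k - 1 := by omega
    have a2 : ((m : ℤ) - 1) / 2 = k - 1 := by omega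
    have z : (S ℝ ((k : ℤ) - 1)).eval (2 * cos (2 * π / m)) = 0 := by
      rw [key]
      have : ((((k : ℤ) - 1 : ℤ) : ℝ) + 1) * (2 * π / m) = π := by
        have : (m : ℝ) = 2 * k := by exact_mod_cast hk
        push_cast
        field_simp
        rw [this]; ring
      rw [this]; simp
    rw [a1, a2, z]
    ext x : 2
    simp
  · have a1 : ((m : ℤ) - 3) / 2 = k - 1 := by omega
    have a2 : ((m : ℤ) - 1) / 2 = k := by omega
    have a3 : ((m : ℤ) - 2) / 2 = k - 1 := by omega
    have a4 : (m : ℤ) / 2 = k := by omega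
    have z : (S ℝ (k : ℤ)).eval (2 * cos (2 * π / m)) +
        (S ℝ ((k : ℤ) - 1)).eval (2 * cos (2 * π / m)) = 0 := by
      rw [key, key, ← add_div]
      have : ((((k : ℤ) - 1 : ℤ) : ℝ) + 1) * (2 * π / m) =
          2 * π - (((k : ℤ) : ℝ) + 1) * (2 * π / m) := by
        have : (m : ℝ) = 2 * k + 1 := by exact_mod_cast hk
        push_cast
        field_simp
        rw [this]; ring
      rw [this, sin_two_pi_sub]; simp
    rw [a1, a2, a3, a4, z]
    ext x : 2
    simp

theorem simple_mul_simple_pow_ne_one {i j : B} (hij : i ≠ j) {p : ℕ} (hp : 0 < p)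
    (h : M i j = 0 ∨ p < M i j) : (cs.simple i * cs.simple j) ^ p ≠ 1 := by
  intro hpow
  have hr := congrArg (cs.lift ⟨_, isLiftable_reflection M⟩) hpow
  rw [map_pow, map_mul, cs.lift_apply_simple, cs.lift_apply_simple, map_one] at hr
  have hx := Module.reflection_mul_reflection_pow_apply_self (coroot_self (M := M) i)
    (coroot_self (M := M) j) p
  rw [coroot_mul_coroot_sub_two, hr, LinearEquiv.coe_one, id] at hx
  have c1 := DFunLike.congr_fun hx i
  have c2 := DFunLike.congr_fun hx j
  simp only [Finsupp.add_apply, Finsupp.smul_apply, Finsupp.single_eq_same,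
    Finsupp.single_eq_of_ne hij, Finsupp.single_eq_of_ne hij.symm, smul_eq_mul, mul_one, mul_zero,
    add_zero, zero_add] at c1 c2
  rw [coroot_single, M.symmetric j i] at c2
  have h1 : M i j ≠ 1 := M.off_diagonal i j hij
  by_cases h0 : M i j = 0
  · simp [h0, S_eval_two] at c2
    omega
  have hpm : p < M i j := by omega
  by_cases h2 : M i j = 2
  · have : p = 1 := by omega
    subst this
    have : 2 * π / ((2 : ℕ) : ℝ) = π := by norm_num
    rw [h2, this] at c1
    simp [S_one] at c1
  have h3 : 3 ≤ M i j := by omega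
  have hs := sin_two_pi_div_pos h3
  generalize M i j = m at *
  have hm : (3 : ℝ) ≤ m := by exact_mod_cast h3
  have hpos := pi_pos
  have hc : cos (π / m) ≠ 0 := by
    apply ne_of_gt
    apply cos_pos_of_mem_Ioo
    constructor
    · have : 0 < π / m := by positivity
      linarith
    · rw [div_lt_iff₀ (by linarith)]
      nlinarith
  have hS : (S ℝ ((p : ℤ) - 1)).eval (2 * cos (2 * π / m)) = 0 := by
    rcases mul_eq_zero.mp c2.symm with h | h
    · exact h
    · exact absurd (by linarith) hc
  have s1 := S_two_mul_real_cos (2 * π / m) (p : ℤ)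
  have s2 := S_two_mul_real_cos (2 * π / m) ((p : ℤ) - 1)
  rw [hS, add_zero] at c1
  rw [hS, zero_mul] at s2
  rw [← c1, one_mul] at s1
  push_cast at s1 s2
  rw [sub_add_cancel] at s2
  rw [add_mul, one_mul, sin_add, ← s2, zero_mul, zero_add] at s1
  have hcos : cos (p * (2 * π / m)) = 1 := by
    have : (cos (p * (2 * π / m)) - 1) * sin (2 * π / m) = 0 := by linarith
    rcases mul_eq_zero.mp this with h | h
    · linarith
    · exact absurd h hs.ne'
  rw [cos_eq_one_iff] at hcos
  obtain ⟨n, hn⟩ := hcos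
  have hn' : (n : ℝ) * m = p := by
    field_simp at hn
    linarith
  have hn2 : n * (m : ℤ) = p := by exact_mod_cast hn'
  have : (m : ℤ) ∣ p := ⟨n, by linarith⟩
  have := Int.le_of_dvd (by omega) this
  omega

end Coxeter

section Inversions

variable {B W : Type*} [Group W] {M : CoxeterMatrix B} (cs : CoxeterSystem M W)

open Classical in
/-- The action of a simple reflection on pairs of a group element and a sign. -/
noncomputable def signedConj (i : B) : Equiv.Perm (W × ZMod 2) :=
  Function.Involutive.toPerm
    (fun p => (cs.simple i * p.1 * cs.simple i, p.2 + if p.1 = cs.simple i then 1 else 0)) <| by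
  rintro ⟨t, e⟩
  have h : cs.simple i * t * cs.simple i = cs.simple i ↔ t = cs.simple i := by
    constructor
    · intro h
      simpa [mul_assoc] using congrArg (fun x => cs.simple i * x * cs.simple i) h
    · rintro rfl; simp
  simp only [h, Prod.mk.injEq, add_assoc, CharTwo.add_self_eq_zero, add_zero, and_true]
  simp [mul_assoc]

open Classical in
lemma signedConj_apply (i : B) (t : W) (e : ZMod 2) : signedConj cs i (t, e) =
    (cs.simple i * t * cs.simple i, e + if t = cs.simple i then 1 else 0) := rfl

lemma simple_mul_pow (i j : B) (n : ℕ) : cs.simple j * (cs.simple i * cs.simple j) ^ n =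
    ((cs.simple i * cs.simple j) ^ n)⁻¹ * cs.simple j := by
  have h : SemiconjBy (cs.simple j) (cs.simple i * cs.simple j) (cs.simple i * cs.simple j)⁻¹ := by
    simp [SemiconjBy, mul_assoc]
  rw [← inv_pow]
  exact h.pow_right n

open Classical in
lemma signedConj_mul_pow (i j : B) (n : ℕ) (t : W) (e : ZMod 2) :
    ((signedConj cs i * signedConj cs j) ^ n) (t, e) =
      ((cs.simple i * cs.simple j) ^ n * t * ((cs.simple i * cs.simple j) ^ n)⁻¹,
        e + ∑ l ∈ Finset.range (2 * n),
          if t = ((cs.simple i * cs.simple j) ^ l)⁻¹ * cs.simple j then 1 else 0) := by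
  induction n with
  | zero => simp
  | succ n ih =>
    rw [pow_succ', Equiv.Perm.mul_apply, ih, Equiv.Perm.mul_apply, signedConj_apply,
      signedConj_apply]
    set c := cs.simple i * cs.simple j with hc
    have h1 : c ^ n * t * (c ^ n)⁻¹ = cs.simple j ↔ t = (c ^ (2 * n))⁻¹ * cs.simple j := by
      rw [mul_inv_eq_iff_eq_mul, simple_mul_pow, ← eq_inv_mul_iff_mul_eq, ← mul_assoc,
        ← mul_inv_rev, ← pow_add, two_mul]
    have h2 : cs.simple j * (c ^ n * t * (c ^ n)⁻¹) * cs.simple j = cs.simple i ↔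
        t = (c ^ (2 * n + 1))⁻¹ * cs.simple j := by
      have : cs.simple j * (c ^ n * t * (c ^ n)⁻¹) * cs.simple j = cs.simple i ↔
          c ^ n * t * (c ^ n)⁻¹ = cs.simple j * c := by
        rw [show cs.simple j * c = cs.simple j * cs.simple i * cs.simple j by simp [hc, mul_assoc],
          mul_assoc, ← eq_inv_mul_iff_mul_eq, ← eq_mul_inv_iff_mul_eq, cs.inv_simple]
      rw [this, mul_inv_eq_iff_eq_mul, mul_assoc, ← pow_succ', simple_mul_pow,
        ← eq_inv_mul_iff_mul_eq, ← mul_assoc, ← mul_inv_rev, ← pow_add]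
      rw [show n + 1 + n = 2 * n + 1 by ring]
    rw [mul_add, mul_one, Finset.sum_range_succ, Finset.sum_range_succ]
    simp only [h1, h2]
    ext1
    · simp [pow_succ', hc, mul_assoc]
    · simp [add_assoc]

lemma isLiftable_signedConj : M.IsLiftable (signedConj cs) := by
  classical
  intro i j
  ext1 ⟨t, e⟩
  rw [signedConj_mul_pow, cs.simple_mul_simple_pow, two_mul, Finset.sum_range_add]
  simp [pow_add, cs.simple_mul_simple_pow, CharTwo.add_self_eq_zero]

/-- The action of the Coxeter group on pairs of a group element and a sign. -/
noncomputable def signedConjHom : W →* Equiv.Perm (W × ZMod 2) :=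
  cs.lift ⟨_, isLiftable_signedConj cs⟩

/-- The parity cocycle, which detects right inversions. -/
noncomputable def invParity (w t : W) : ZMod 2 := (signedConjHom cs w (t, 0)).2

open Classical in
lemma signedConjHom_simple_apply (i : B) (t : W) (e : ZMod 2) :
    signedConjHom cs (cs.simple i) (t, e) =
    (cs.simple i * t * cs.simple i, e + if t = cs.simple i then 1 else 0) := by
  rw [signedConjHom, cs.lift_apply_simple, signedConj_apply]

lemma signedConjHom_apply (w t : W) (e : ZMod 2) :
    signedConjHom cs w (t, e) = (w * t * w⁻¹, e + invParity cs w t) := by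
  classical
  unfold invParity
  induction w using cs.simple_induction_left generalizing t e with
  | one => simp
  | mul_simple_left w i ih =>
    rw [map_mul, Equiv.Perm.mul_apply, ih, signedConjHom_simple_apply, Equiv.Perm.mul_apply,
      ih t 0, signedConjHom_simple_apply]
    simp [mul_assoc, add_assoc]

lemma invParity_mul (u v t : W) :
    invParity cs (u * v) t = invParity cs v t + invParity cs u (v * t * v⁻¹) := by
  rw [invParity, map_mul, Equiv.Perm.mul_apply, signedConjHom_apply, signedConjHom_apply, zero_add]

@[simp] lemma invParity_one (t : W) : invParity cs 1 t = 0 := by simp [invParity]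

lemma invParity_self {t : W} (ht : cs.IsReflection t) : invParity cs t t = 1 := by
  classical
  obtain ⟨w, i, rfl⟩ := ht
  have h := invParity_mul cs w w⁻¹ (w * cs.simple i * w⁻¹)
  rw [mul_inv_cancel, invParity_one] at h
  have h1 : invParity cs (cs.simple i) (cs.simple i) = 1 := by
    simp [invParity, signedConjHom_simple_apply]
  rw [invParity_mul, invParity_mul]
  simp only [mul_assoc, inv_mul_cancel_left, inv_inv, inv_mul_cancel, mul_one, one_mul,
    cs.inv_simple, cs.simple_mul_simple_self, h1] at h ⊢
  rw [add_left_comm, ← h, add_zero]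

lemma invParity_wordProd {ω : List B} {t : W} (h : t ∉ cs.rightInvSeq ω) :
    invParity cs (cs.wordProd ω) t = 0 := by
  classical
  induction ω with
  | nil => simp
  | cons i ω ih =>
    rw [CoxeterSystem.rightInvSeq, List.mem_cons, not_or] at h
    rw [cs.wordProd_cons, invParity_mul, ih h.2, zero_add, invParity, signedConjHom_simple_apply,
      if_neg]
    · simp
    · intro h'
      apply h.1
      rw [← h']; group

theorem invParity_eq_one_iff {t : W} (ht : cs.IsReflection t) (w : W) :
    invParity cs w t = 1 ↔ cs.length (w * t) < cs.length w := by
  have key : ∀ w, invParity cs w t ≠ 0 → cs.length (w * t) < cs.length w := by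
    intro w hw
    obtain ⟨ω, hω, rfl⟩ := cs.exists_isReduced w
    by_contra hlt
    exact hw (invParity_wordProd cs fun hm =>
      hlt (cs.isRightInversion_of_mem_rightInvSeq hω hm).2)
  constructor
  · intro h
    exact key w (by rw [h]; decide)
  · intro h
    by_contra h1
    have h2 := key (w * t) (by
      rw [invParity_mul, invParity_self cs ht, mul_inv_cancel_right]
      generalize invParity cs w t = x at *
      revert x; decide)
    rw [mul_assoc, ht.mul_self, mul_one] at h2
    omega

/-- Left inversions of a product. -/
theorem length_reflection_mul_mul_lt_iff {t : W} (ht : cs.IsReflection t) (u w : W) :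
    cs.length (t * (u * w)) < cs.length (u * w) ↔
      Xor (cs.length (t * u) < cs.length u) (cs.length (u⁻¹ * t * u * w) < cs.length w) := by
  have inv : ∀ {t : W} (_ : cs.IsReflection t) (w : W),
      cs.length (t * w) < cs.length w ↔ invParity cs w⁻¹ t = 1 := by
    intro t ht w
    rw [invParity_eq_one_iff cs ht, ← cs.length_inv (t * w), ← cs.length_inv w, mul_inv_rev, ht.inv]
  have ht' : cs.IsReflection (u⁻¹ * t * u) := by simpa using ht.conj u⁻¹
  rw [inv ht, inv ht, inv ht', mul_inv_rev, invParity_mul, inv_inv]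
  generalize invParity cs u⁻¹ t = x
  generalize invParity cs w⁻¹ (u⁻¹ * t * u) = y
  revert x y
  unfold Xor
  decide

end Inversions

section Words

variable {B W : Type*} [Group W] {M : CoxeterMatrix B} (cs : CoxeterSystem M W)

/-- The alternating word with `k` letters starting with `i`. -/
def altL (i j : B) : ℕ → List B
  | 0 => []
  | k + 1 => i :: altL j i k

@[simp] lemma length_altL (i j : B) (k : ℕ) : (altL i j k).length = k := by
  induction k generalizing i j with
  | zero => rfl
  | succ k ih => simp [altL, ih]

lemma altL_succ' (i j : B) (k : ℕ) :
    altL i j (k + 1) = altL i j k ++ [if Even k then i else j] := by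
  induction k generalizing i j with
  | zero => simp [altL]
  | succ k ih =>
    rw [altL, ih, altL]
    by_cases h : Even k <;> simp [h, Nat.even_add_one]

lemma wordProd_altL_mul_inv (i j : B) (k : ℕ) :
    cs.wordProd (altL i j k) * (cs.wordProd (altL j i k))⁻¹ =
      (cs.simple i * cs.simple j) ^ k := by
  induction k generalizing i j with
  | zero => simp [altL]
  | succ k ih =>
    rw [altL, altL, cs.wordProd_cons, cs.wordProd_cons, mul_inv_rev, cs.inv_simple, mul_assoc,
      ← mul_assoc (cs.wordProd _), ih, ← mul_assoc, ← mul_pow_mul, mul_assoc, ← pow_succ]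

lemma wordProd_altL_comm (i j : B) :
    cs.wordProd (altL i j (M i j)) = cs.wordProd (altL j i (M i j)) := by
  rw [← mul_inv_eq_one, wordProd_altL_mul_inv, cs.simple_mul_simple_pow]

lemma exists_of_length_mul_wordProd_altL_lt {t : W} (ht : cs.IsReflection t) (i j : B) (k : ℕ)
    (h : cs.length (t * cs.wordProd (altL i j k)) < cs.length (cs.wordProd (altL i j k))) :
    ∃ p < k, t = (cs.simple i * cs.simple j) ^ p * cs.simple i := by
  induction k generalizing i j t with
  | zero => simp [altL] at h
  | succ k ih =>
    rw [altL, cs.wordProd_cons, length_reflection_mul_mul_lt_iff cs ht] at h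
    rcases h with ⟨h, -⟩ | ⟨h, -⟩
    · rw [cs.length_simple, Nat.lt_one_iff, cs.length_eq_zero_iff, mul_eq_one_iff_eq_inv,
        cs.inv_simple] at h
      exact ⟨0, by omega, by simp [h]⟩
    · have ht' := ht.conj (cs.simple i)⁻¹
      rw [inv_inv] at ht'
      obtain ⟨p, hp, h'⟩ := ih ht' j i h
      refine ⟨p + 1, by omega, ?_⟩
      rw [mul_assoc, inv_mul_eq_iff_eq_mul, ← eq_mul_inv_iff_mul_eq, cs.inv_simple] at h'
      rw [h', pow_succ, ← mul_assoc, ← mul_pow_mul]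
      simp only [mul_assoc]

lemma not_length_simple_mul_wordProd_altL_lt {i j : B} (hij : i ≠ j) {k : ℕ}
    (hk : M i j = 0 ∨ k < M i j) :
    ¬ cs.length (cs.simple j * cs.wordProd (altL i j k)) <
      cs.length (cs.wordProd (altL i j k)) := by
  intro h
  obtain ⟨p, hp, h'⟩ := exists_of_length_mul_wordProd_altL_lt cs (cs.isReflection_simple j) i j k h
  apply simple_mul_simple_pow_ne_one cs hij (Nat.succ_pos p) (by omega)
  rw [Nat.succ_eq_add_one, pow_succ, ← mul_assoc, ← h', cs.simple_mul_simple_self]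

lemma isReduced_altL {i j : B} (hij : i ≠ j) {k : ℕ} (hk : M i j = 0 ∨ k ≤ M i j) :
    cs.IsReduced (altL i j k) := by
  induction k generalizing i j with
  | zero => simp [altL, CoxeterSystem.IsReduced]
  | succ k ih =>
    rw [← M.symmetric j i] at hk
    have h1 := not_length_simple_mul_wordProd_altL_lt cs hij.symm (k := k) (by omega)
    have h2 := (ih hij.symm (by omega)).eq
    rw [CoxeterSystem.IsReduced, altL, cs.wordProd_cons]
    have := cs.length_simple_mul (cs.wordProd (altL j i k)) i
    simp only [List.length_cons] at *
    omega

lemma exists_eq_wordProd_altL_mul {w : W} {i j : B} (hij : i ≠ j) (hi : cs.IsLeftDescent w i)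
    (hj : cs.IsLeftDescent w j) {k : ℕ} (hk : M i j = 0 ∨ k ≤ M i j) :
    ∃ v, w = cs.wordProd (altL i j k) * v ∧ cs.length w = k + cs.length v := by
  induction k generalizing i j with
  | zero => exact ⟨w, by simp [altL]⟩
  | succ k ih =>
    rw [← M.symmetric j i] at hk
    obtain ⟨v, hv, hl⟩ := ih hij.symm hj hi (by omega)
    have h1 := not_length_simple_mul_wordProd_altL_lt cs hij.symm (k := k) (by omega)
    rw [CoxeterSystem.IsLeftDescent, hv,
      length_reflection_mul_mul_lt_iff cs (cs.isReflection_simple i)] at hi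
    rcases hi with ⟨h, -⟩ | ⟨h, -⟩
    · exact absurd h h1
    have hw : w = cs.wordProd (altL i j (k + 1)) *
        ((cs.wordProd (altL j i k))⁻¹ * cs.simple i * cs.wordProd (altL j i k) * v) := by
      rw [altL, cs.wordProd_cons, hv]
      simp [mul_assoc]
    refine ⟨_, hw, le_antisymm ?_ (by omega)⟩
    conv_lhs => rw [hw]
    refine (cs.length_mul_le _ _).trans (Nat.add_le_add_right ?_ _)
    simpa using cs.length_wordProd_le (altL i j (k + 1))

/-- **Matsumoto's theorem**: a family satisfying the braid relations extends to reduced words. -/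
theorem prod_map_eq_of_isReduced {H : Type*} [Monoid H] (T : B → H)
    (hT : ∀ i j, i ≠ j → M i j ≠ 0 →
      ((altL i j (M i j)).map T).prod = ((altL j i (M i j)).map T).prod)
    {ω ω' : List B} (hω : cs.IsReduced ω) (hω' : cs.IsReduced ω')
    (h : cs.wordProd ω = cs.wordProd ω') : (ω.map T).prod = (ω'.map T).prod := by
  have hlen : ω.length = ω'.length := by rw [← hω.eq, ← hω'.eq, h]
  induction hn : ω.length using Nat.strong_induction_on generalizing ω ω' with
  | _ n ih =>
  have same : ∀ {a : B} {ν ν' : List B}, cs.IsReduced (a :: ν) → cs.IsReduced (a :: ν') →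
      cs.wordProd (a :: ν) = cs.wordProd (a :: ν') → (a :: ν).length = n →
      ((a :: ν).map T).prod = ((a :: ν').map T).prod := by
    intro a ν ν' hν hν' hp hl
    have h1 : cs.IsReduced ν := hν.drop 1
    have h2 : cs.IsReduced ν' := hν'.drop 1
    have h3 : cs.wordProd ν = cs.wordProd ν' := by
      simpa only [cs.wordProd_cons, mul_right_inj] using hp
    rw [List.map_cons, List.map_cons, List.prod_cons, List.prod_cons,
      ih ν.length (by simp at hl; omega) h1 h2 h3 (by rw [← h1.eq, ← h2.eq, h3]) rfl]
  match ω, ω' with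
  | [], [] => rfl
  | [], _ :: _ => simp at hlen
  | _ :: _, [] => simp at hlen
  | i :: ω, j :: ω' =>
    by_cases hij : i = j
    · subst hij
      exact same hω hω' h hn
    have descent : ∀ {a : B} {ν : List B}, cs.IsReduced (a :: ν) →
        cs.IsLeftDescent (cs.wordProd (a :: ν)) a := by
      intro a ν hν
      have h1 : cs.IsReduced ν := hν.drop 1
      rw [CoxeterSystem.IsLeftDescent, hν.eq, cs.wordProd_cons, cs.simple_mul_simple_cancel_left,
        h1.eq]
      simp
    have hi := descent hω
    have hj := descent hω'
    rw [← h] at hj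
    by_cases h0 : M i j = 0
    · obtain ⟨v, -, hl⟩ := exists_eq_wordProd_altL_mul cs hij hi hj
        (k := cs.length (cs.wordProd (i :: ω)) + 1) (Or.inl h0)
      omega
    obtain ⟨v, hv, hl⟩ := exists_eq_wordProd_altL_mul cs hij hi hj (k := M i j) (Or.inr le_rfl)
    obtain ⟨ν, hν, rfl⟩ := cs.exists_isReduced v
    rw [← cs.wordProd_append] at hv
    have r1 : cs.IsReduced (altL i j (M i j) ++ ν) := by
      rw [CoxeterSystem.IsReduced, ← hv, hl, hν.eq]; simp
    have r2 : cs.IsReduced (altL j i (M i j) ++ ν) := by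
      rw [CoxeterSystem.IsReduced, cs.wordProd_append, ← wordProd_altL_comm, ← cs.wordProd_append,
        ← hv, hl, hν.eq]; simp
    have hv' : cs.wordProd (j :: ω') = cs.wordProd (altL j i (M i j) ++ ν) := by
      rw [← h, hv, cs.wordProd_append, cs.wordProd_append, wordProd_altL_comm]
    have hTij := hT i j hij h0
    obtain ⟨m, hm⟩ := Nat.exists_eq_succ_of_ne_zero h0
    rw [hm, altL, List.cons_append] at r1 r2 hv hv'
    rw [same hω r1 hv hn, same hω' r2 hv' (by omega)]
    rw [hm, altL] at hTij
    rw [← List.cons_append, ← List.cons_append, List.map_append, List.map_append, List.prod_append,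
      List.prod_append, hTij, altL]

end Words

section Representation

variable {B : Type*} (M : CoxeterMatrix B)

lemma hs_mul_self (i : B) : hs M i * hs M i = 1 := by
  simpa [hs] using RingQuot.mkAlgHom_rel ℤ (Rel.s_sq (M := M) i)

lemma hD_mul_self (i : B) : hD M i * hD M i = hD M i := by
  simpa [hD] using RingQuot.mkAlgHom_rel ℤ (Rel.D_sq (M := M) i)

lemma hs_mul_hD_add (i : B) : hs M i * hD M i + hD M i * hs M i = hs M i - 1 := by
  simpa [hD, hs] using RingQuot.mkAlgHom_rel ℤ (Rel.sD (M := M) i)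

variable {M} {W : Type*} [Group W] (cs : CoxeterSystem M W) (k : Type*) [CommRing k]

/-- Left translation by `v` on the free module on the Coxeter group. -/
noncomputable def transl (v : W) : Module.End k (W →₀ k) :=
  Finsupp.lmapDomain k k (v * ·)

open Classical in
/-- The action of `D_t` on the free module on the Coxeter group. -/
noncomputable def demazure (t : W) : Module.End k (W →₀ k) :=
  Finsupp.linearCombination k fun w =>
    if cs.length (t * w) < cs.length w then
      Finsupp.single w (1 : k) - Finsupp.single (t * w) 1 else 0

@[simp] lemma transl_single (v w : W) (c : k) :
    transl k v (Finsupp.single w c) = Finsupp.single (v * w) c := by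
  simp [transl]

open Classical in
lemma demazure_single (t w : W) : demazure cs k t (Finsupp.single w 1) =
    if cs.length (t * w) < cs.length w then
      Finsupp.single w (1 : k) - Finsupp.single (t * w) 1 else 0 := by
  simp [demazure]

lemma transl_mul (u v : W) : transl k (u * v) = transl k u * transl k v := by
  ext w : 2
  simp [mul_assoc]

lemma transl_one : transl k (1 : W) = 1 := by
  ext w : 2
  simp

lemma length_conj_lt_iff {t : W} (ht : cs.IsReflection t) (u w : W)
    (h : ¬ cs.length (t * u) < cs.length u) :
    cs.length (t * (u * w)) < cs.length (u * w) ↔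
      cs.length (u⁻¹ * t * u * w) < cs.length w := by
  rw [length_reflection_mul_mul_lt_iff _ ht]
  simp [Xor, h]

lemma demazure_mul_transl {t : W} (ht : cs.IsReflection t) (u : W)
    (h : ¬ cs.length (t * u) < cs.length u) :
    demazure cs k t * transl k u = transl k u * demazure cs k (u⁻¹ * t * u) := by
  classical
  ext w : 2
  simp only [LinearMap.comp_apply, Finsupp.lsingle_apply, Module.End.mul_apply, transl_single,
    demazure_single, length_conj_lt_iff cs ht u w h]
  split_ifs
  · simp [mul_assoc]
  · simp

lemma length_simple_mul_mul_simple_mul_lt_iff (i : B) (w : W) :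
    cs.length (cs.simple i * (cs.simple i * w)) < cs.length (cs.simple i * w)
      ↔ ¬ cs.length (cs.simple i * w) < cs.length w := by
  rw [cs.simple_mul_simple_cancel_left]
  have := cs.length_simple_mul_ne w i
  omega

/-- The images of the generators in the representation on the free module. -/
noncomputable def repGen : Gen B → Module.End k (W →₀ k)
  | Gen.s i => transl k (cs.simple i)
  | Gen.D i => demazure cs k (cs.simple i)

lemma lift_repGen_altS (i j : B) (n : ℕ) :
    FreeAlgebra.lift ℤ (repGen cs k) (altS i j n) =
      transl k (cs.wordProd (altL i j n)) := by
  induction n generalizing i j with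
  | zero => simp [altS, altL, transl_one]
  | succ n ih => simp [altS, altL, ih, CoxeterSystem.wordProd_cons, transl_mul, fs, repGen]

lemma repGen_rel {x y : F B} (h : Rel M x y) :
    FreeAlgebra.lift ℤ (repGen cs k) x = FreeAlgebra.lift ℤ (repGen cs k) y := by
  classical
  induction h with
  | s_sq i => simp [fs, repGen, ← transl_mul, transl_one]
  | D_sq i =>
    simp only [map_mul, fD, FreeAlgebra.lift_ι_apply, repGen]
    ext w : 2
    by_cases h : cs.length (cs.simple i * w) < cs.length w
    · simp [demazure_single, h, h.le]
    · simp [demazure_single, h]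
  | sD i =>
    simp only [map_mul, map_add, map_sub, map_one, fs, fD, FreeAlgebra.lift_ι_apply, repGen]
    ext w : 2
    by_cases h : cs.length (cs.simple i * w) < cs.length w
    · simp [demazure_single, h, h.le]
    · have := (length_simple_mul_mul_simple_mul_lt_iff cs i w).2 h
      rw [cs.simple_mul_simple_cancel_left] at this
      simp [demazure_single, h, this]
  | coxeter i j =>
    have : ∀ n, (transl k (cs.simple i) * transl k (cs.simple j)) ^ n =
        transl k ((cs.simple i * cs.simple j) ^ n) := by
      intro n
      induction n with
      | zero => simp [transl_one]
      | succ n ih => rw [pow_succ, ih, pow_succ, transl_mul, transl_mul]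
    simp [fs, repGen, this, cs.simple_mul_simple_pow, transl_one]
  | braidLin i j hij h0 =>
    simp only [map_mul, lift_repGen_altS, fD, FreeAlgebra.lift_ι_apply, repGen]
    obtain ⟨m, hm⟩ := Nat.exists_eq_succ_of_ne_zero h0
    rw [demazure_mul_transl cs k (cs.isReflection_simple i) _
      (not_length_simple_mul_wordProd_altL_lt _ hij.symm (by rw [M.symmetric j i]; omega))]
    congr 2
    rw [mul_assoc, inv_mul_eq_iff_eq_mul]
    have h := wordProd_altL_comm cs i j
    rw [hm, altL_succ' j i, altL, CoxeterSystem.wordProd_cons, CoxeterSystem.wordProd_append] at h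
    rw [hm, Nat.succ_eq_add_one, Nat.add_sub_cancel, h, CoxeterSystem.wordProd_singleton]
    congr 2
    by_cases he : Even m
    · rw [if_pos he, if_neg (by rw [Nat.even_iff] at he; omega)]
    · rw [if_neg he, if_pos (by rw [Nat.even_iff] at he; omega)]

/-- The representation of `Ĥ(W)` on the free module on the Coxeter group. -/
noncomputable def rep : HW M →ₐ[ℤ] Module.End k (W →₀ k) :=
  RingQuot.liftAlgHom ℤ ⟨FreeAlgebra.lift ℤ (repGen cs k), fun _ _ h => repGen_rel cs k h⟩

@[simp] lemma rep_hs (i : B) : rep cs k (hs M i) = transl k (cs.simple i) := by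
  simp [rep, hs, fs, repGen]

@[simp] lemma rep_hD (i : B) : rep cs k (hD M i) = demazure cs k (cs.simple i) := by
  simp [rep, hD, fD, repGen]

lemma reflection_induction {P : W → Prop} (simple : ∀ i, P (cs.simple i))
    (conj : ∀ i t, cs.IsReflection t → t ≠ cs.simple i → P t → P (cs.simple i * t * cs.simple i))
    {t : W} (ht : cs.IsReflection t) : P t := by
  obtain ⟨w, j, rfl⟩ := ht
  induction w using cs.simple_induction_left with
  | one => simpa using simple j
  | mul_simple_left w i ih =>
    have e : cs.simple i * w * cs.simple j * (cs.simple i * w)⁻¹ =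
        cs.simple i * (w * cs.simple j * w⁻¹) * cs.simple i := by
      simp [mul_assoc]
    rw [e]
    by_cases h : w * cs.simple j * w⁻¹ = cs.simple i
    · simpa [h] using simple i
    · exact conj i _ ⟨w, j, rfl⟩ h ih

/-- The data of the embedding of the Coxeter group in `Ĥ(W)`, the elements `D_t` (extended by zero
to all elements of the group), and the counit. -/
structure HopfData (cs : CoxeterSystem M W) where
  π : W →* (HW M)ˣ
  π_simple : ∀ i, (π (cs.simple i) : HW M) = hs M i
  D : W → HW M
  D_eq_zero : ∀ t, ¬ cs.IsReflection t → D t = 0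
  D_simple : ∀ i, D (cs.simple i) = hD M i
  D_conj : ∀ i t, t ≠ cs.simple i → hs M i * D t * hs M i = D (cs.simple i * t * cs.simple i)
  ε : HW M →ₐ[ℤ] ℤ
  ε_D : ∀ i, ε (hD M i) = 0

/-- The intersection of the conjugates of the subalgebra generated by the `D_t`. -/
def HopfData.K {cs : CoxeterSystem M W} (S : HopfData cs) : Set (HW M) :=
  {x | ∀ w : W, (S.π w : HW M) * x * (((S.π w)⁻¹ : (HW M)ˣ) : HW M) ∈
    Algebra.adjoin ℤ (Set.range S.D)}

variable {cs} (S : HopfData cs)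

lemma HopfData.ε_D_eq_zero (t : W) : S.ε (S.D t) = 0 := by
  by_cases ht : cs.IsReflection t
  · refine reflection_induction cs (P := fun t => S.ε (S.D t) = 0) (fun i => ?_)
      (fun i t _ h ih => ?_) ht
    · rw [S.D_simple, S.ε_D]
    · rw [← S.D_conj i t h, map_mul, map_mul, ih, mul_zero, zero_mul]
  · rw [S.D_eq_zero t ht, map_zero]

lemma HopfData.rep_π (w : W) : rep cs k (S.π w : HW M) = transl k w := by
  induction w using cs.simple_induction_left with
  | one => simp [transl_one]
  | mul_simple_left w i ih => simp [ih, transl_mul, S.π_simple]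

lemma not_length_mul_simple_lt {i : B} {t : W} (h : t ≠ cs.simple i) :
    ¬ cs.length (t * cs.simple i) < cs.length (cs.simple i) := by
  rw [cs.length_simple, Nat.lt_one_iff, cs.length_eq_zero_iff, mul_eq_one_iff_eq_inv,
    cs.inv_simple]
  exact h

lemma HopfData.rep_D {t : W} (ht : cs.IsReflection t) : rep cs k (S.D t) = demazure cs k t := by
  refine reflection_induction cs (P := fun t => rep cs k (S.D t) = demazure cs k t) (fun i => ?_)
    (fun i t ht h ih => ?_) ht
  · rw [S.D_simple, rep_hD]
  · rw [← S.D_conj i t h, map_mul, map_mul, ih, rep_hs, mul_assoc,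
      demazure_mul_transl cs k ht _ (not_length_mul_simple_lt h), ← mul_assoc, ← transl_mul,
      cs.simple_mul_simple_self, transl_one, one_mul, cs.inv_simple]

lemma HopfData.rep_apply_one_of_mem_adjoin {x : HW M}
    (hx : x ∈ Algebra.adjoin ℤ (Set.range S.D)) :
    rep cs k x (Finsupp.single 1 1) = S.ε x • Finsupp.single (1 : W) (1 : k) := by
  classical
  induction hx using Algebra.adjoin_induction with
  | mem x hx =>
    obtain ⟨t, rfl⟩ := hx
    rw [S.ε_D_eq_zero, zero_smul]
    by_cases ht : cs.IsReflection t
    · rw [S.rep_D k ht, demazure_single, if_neg (by simp)]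
    · rw [S.D_eq_zero t ht, map_zero, LinearMap.zero_apply]
  | algebraMap r => simp
  | add x y _ _ hx hy => rw [map_add, LinearMap.add_apply, hx, hy, map_add, add_smul]
  | mul x y _ _ hx hy =>
    rw [map_mul, Module.End.mul_apply, hy, map_zsmul, hx, map_mul, mul_comm, mul_smul]

lemma HopfData.rep_eq_zero {x : HW M} (hx : x ∈ S.K) (hε : S.ε x = 0) : rep cs k x = 0 := by
  ext w : 2
  have h := S.rep_apply_one_of_mem_adjoin k (hx w⁻¹)
  have hw : (((S.π w⁻¹)⁻¹ : (HW M)ˣ) : HW M) = S.π w := by simp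
  rw [hw, map_mul S.ε, map_mul S.ε, hε, mul_zero, zero_mul, zero_smul, map_mul, map_mul,
    Module.End.mul_apply, Module.End.mul_apply, S.rep_π k, S.rep_π k, transl_single, mul_one] at h
  have h' := congrArg (transl k w) h
  rw [← Module.End.mul_apply, ← transl_mul, mul_inv_cancel, transl_one, map_zero] at h'
  simpa using h'

end Representation

section HeckeBasis

variable {B : Type*} {M : CoxeterMatrix B} {W : Type*} [Group W] (cs : CoxeterSystem M W)
  (k : Type*) [CommRing k] (q : B → k)

/-- A chosen reduced word. -/
noncomputable def redWord (w : W) : List B := (cs.exists_isReduced w).choose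

lemma isReduced_redWord (w : W) : cs.IsReduced (redWord cs w) :=
  (cs.exists_isReduced w).choose_spec.1

@[simp] lemma wordProd_redWord (w : W) : cs.wordProd (redWord cs w) = w :=
  (cs.exists_isReduced w).choose_spec.2.symm

@[simp] lemma length_redWord (w : W) : (redWord cs w).length = cs.length w := by
  rw [← (isReduced_redWord cs w).eq, wordProd_redWord]

lemma altT_eq_prod (i j : B) (n : ℕ) : altT k i j n = ((altL i j n).map (fT k)).prod := by
  induction n generalizing i j with
  | zero => simp [altT, altL]
  | succ n ih => simp [altT, altL, ih]

lemma map_prod_altL_tW (M : CoxeterMatrix B) {i j : B} (hij : i ≠ j) (h : M i j ≠ 0) :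
    ((altL i j (M i j)).map (tW k M q)).prod = ((altL j i (M i j)).map (tW k M q)).prod := by
  have h := RingQuot.mkAlgHom_rel k (HqRel.braid (k := k) (q := q) i j hij h)
  rw [altT_eq_prod, altT_eq_prod, map_list_prod, map_list_prod, List.map_map, List.map_map] at h
  exact h

lemma tW_mul_tW (M : CoxeterMatrix B) (i : B) :
    tW k M q i * tW k M q i = (1 - q i) • tW k M q i + algebraMap k _ (q i) := by
  have h := RingQuot.mkAlgHom_rel k (HqRel.quad (k := k) (M := M) (q := q) i)
  rw [map_mul, map_add, map_mul, AlgHom.commutes, AlgHom.commutes, ← Algebra.smul_def] at h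
  exact h

/-- The standard basis elements of the Hecke algebra. -/
noncomputable def stdT (w : W) : HqW k M q := ((redWord cs w).map (tW k M q)).prod

lemma stdT_eq {ω : List B} (hω : cs.IsReduced ω) :
    stdT cs k q (cs.wordProd ω) = (ω.map (tW k M q)).prod :=
  prod_map_eq_of_isReduced cs _ (fun _ _ hij h => map_prod_altL_tW k q M hij h)
    (isReduced_redWord cs _) hω (by simp)

lemma tW_mul_stdT_of_lt {i : B} {w : W} (h : ¬ cs.length (cs.simple i * w) < cs.length w) :
    tW k M q i * stdT cs k q w = stdT cs k q (cs.simple i * w) := by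
  have hr : cs.IsReduced (i :: redWord cs w) := by
    rw [CoxeterSystem.IsReduced, cs.wordProd_cons, wordProd_redWord, List.length_cons,
      length_redWord]
    have := cs.length_simple_mul w i
    omega
  have := stdT_eq cs k q hr
  rw [cs.wordProd_cons, wordProd_redWord] at this
  rw [this, List.map_cons, List.prod_cons, stdT]

lemma tW_mul_mem_span {i : B} {z : HqW k M q}
    (hz : z ∈ Submodule.span k (Set.range (stdT cs k q))) :
    tW k M q i * z ∈ Submodule.span k (Set.range (stdT cs k q)) := by
  induction hz using Submodule.span_induction with
  | mem z hz =>
    obtain ⟨w, rfl⟩ := hz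
    by_cases h : cs.length (cs.simple i * w) < cs.length w
    · have h' : ¬ cs.length (cs.simple i * (cs.simple i * w)) < cs.length (cs.simple i * w) := by
        rw [length_simple_mul_mul_simple_mul_lt_iff]
        simpa using h
      have e := tW_mul_stdT_of_lt cs k q h'
      rw [cs.simple_mul_simple_cancel_left] at e
      rw [← e, ← mul_assoc, tW_mul_tW, add_mul, smul_mul_assoc, e, ← Algebra.smul_def]
      exact add_mem (Submodule.smul_mem _ _ (Submodule.subset_span ⟨_, rfl⟩))
        (Submodule.smul_mem _ _ (Submodule.subset_span ⟨_, rfl⟩))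
    · rw [tW_mul_stdT_of_lt cs k q h]
      exact Submodule.subset_span ⟨_, rfl⟩
  | zero => rw [mul_zero]; exact zero_mem _
  | add x y _ _ hx hy => rw [mul_add]; exact add_mem hx hy
  | smul c x _ hx => rw [mul_smul_comm]; exact Submodule.smul_mem _ _ hx

lemma span_stdT : Submodule.span k (Set.range (stdT cs k q)) = ⊤ := by
  have key : ∀ y : FreeAlgebra k B, ∀ z ∈ Submodule.span k (Set.range (stdT cs k q)),
      RingQuot.mkAlgHom k (HqRel k M q) y * z ∈ Submodule.span k (Set.range (stdT cs k q)) := by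
    intro y
    induction y using FreeAlgebra.induction with
    | grade0 r =>
      intro z hz
      rw [AlgHom.commutes, ← Algebra.smul_def]
      exact Submodule.smul_mem _ _ hz
    | grade1 i => exact fun z hz => tW_mul_mem_span cs k q hz
    | mul a b ha hb =>
      intro z hz
      rw [map_mul, mul_assoc]
      exact ha _ (hb _ hz)
    | add a b ha hb =>
      intro z hz
      rw [map_add, add_mul]
      exact add_mem (ha _ hz) (hb _ hz)
  have h1 : (1 : HqW k M q) ∈ Submodule.span k (Set.range (stdT cs k q)) := by
    have := stdT_eq cs k q (ω := []) (by simp [CoxeterSystem.IsReduced])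
    rw [List.map_nil, List.prod_nil] at this
    rw [← this]
    exact Submodule.subset_span ⟨_, rfl⟩
  rw [eq_top_iff]
  intro x _
  obtain ⟨y, rfl⟩ := RingQuot.mkAlgHom_surjective k (HqRel k M q) x
  simpa using key y 1 h1

/-- The operator by which `T_i` acts on the free module on the Coxeter group. -/
noncomputable def heckeOp (i : B) : Module.End k (W →₀ k) :=
  transl k (cs.simple i) + (1 - q i) • demazure cs k (cs.simple i)

lemma heckeOp_mem_supported {i : B} {n : ℕ} {x : W →₀ k}
    (hx : x ∈ Finsupp.supported k k {w | cs.length w < n}) :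
    heckeOp cs k q i x ∈ Finsupp.supported k k {w | cs.length w < n + 1} := by
  classical
  rw [Finsupp.supported_eq_span_single] at hx
  induction hx using Submodule.span_induction with
  | mem x hx =>
    obtain ⟨w, hw, rfl⟩ := hx
    have hw' : cs.length w < n := hw
    have h1 := Finsupp.single_mem_supported k (1 : k) (s := {w | cs.length w < n + 1})
      (show cs.length w < n + 1 by omega)
    have h2 := Finsupp.single_mem_supported k (1 : k) (s := {w | cs.length w < n + 1})
      (a := cs.simple i * w) (by
        have := cs.length_simple_mul w i
        show cs.length (cs.simple i * w) < n + 1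
        omega)
    rw [heckeOp, LinearMap.add_apply, LinearMap.smul_apply, transl_single, demazure_single]
    refine add_mem h2 (Submodule.smul_mem _ _ ?_)
    split_ifs
    · exact sub_mem h1 h2
    · exact zero_mem _
  | zero => rw [map_zero]; exact zero_mem _
  | add x y _ _ hx hy => rw [map_add]; exact add_mem hx hy
  | smul c x _ hx => rw [map_smul]; exact Submodule.smul_mem _ _ hx

lemma prod_heckeOp_sub_mem_supported {ω : List B} (hω : cs.IsReduced ω) :
    (ω.map (heckeOp cs k q)).prod (Finsupp.single 1 1) - Finsupp.single (cs.wordProd ω) 1 ∈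
      Finsupp.supported k k {w | cs.length w < ω.length} := by
  classical
  induction ω with
  | nil => simp
  | cons i ω ih =>
    have hr : cs.IsReduced ω := hω.drop 1
    have h := heckeOp_mem_supported cs k q (i := i) (ih hr)
    have hlt : ¬ cs.length (cs.simple i * cs.wordProd ω) < cs.length (cs.wordProd ω) := by
      rw [← cs.wordProd_cons, hω.eq, hr.eq]
      simp
    have e : heckeOp cs k q i (Finsupp.single (cs.wordProd ω) 1) =
        Finsupp.single (cs.wordProd (i :: ω)) 1 := by
      rw [heckeOp, LinearMap.add_apply, LinearMap.smul_apply, transl_single, demazure_single,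
        if_neg hlt, smul_zero, add_zero, cs.wordProd_cons]
    rw [map_sub, e] at h
    simpa using h

lemma linearIndependent_of_unitriangular {v : W → W →₀ k}
    (hv : ∀ w, v w - Finsupp.single w 1 ∈
      Finsupp.supported k k {w' | cs.length w' < cs.length w}) : LinearIndependent k v := by
  classical
  rw [linearIndependent_iff]
  intro c hc
  by_contra hne
  obtain ⟨w, hw, hmax⟩ := c.support.exists_max_image cs.length (Finsupp.support_nonempty_iff.2 hne)
  have hval : ∀ u w, cs.length u ≤ cs.length w → v u w = Finsupp.single u (1 : k) w := by
    intro u w huw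
    have := (Finsupp.mem_supported' k _).1 (hv u) w (by simpa using huw)
    rwa [Finsupp.sub_apply, sub_eq_zero] at this
  have h := DFunLike.congr_fun hc w
  rw [Finsupp.linearCombination_apply, Finsupp.sum_apply, Finsupp.sum, Finset.sum_eq_single w] at h
  · rw [Finsupp.smul_apply, hval w w le_rfl] at h
    simp at h
    exact Finsupp.mem_support_iff.1 hw h
  · intro u hu huw
    rw [Finsupp.smul_apply, hval u w (hmax u hu), Finsupp.single_eq_of_ne huw.symm, smul_zero]
  · intro h'
    exact absurd hw h'

theorem injective_of_heckeOp (Ψ : HqW k M q →ₐ[k] Module.End k (W →₀ k))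
    (hΨ : ∀ i, Ψ (tW k M q i) = heckeOp cs k q i) : Function.Injective Ψ := by
  have hind : LinearIndependent k fun w => Ψ (stdT cs k q w) (Finsupp.single 1 1) := by
    apply linearIndependent_of_unitriangular cs
    intro w
    have h := prod_heckeOp_sub_mem_supported cs k q (isReduced_redWord cs w)
    rw [wordProd_redWord, length_redWord] at h
    have e : Ψ (stdT cs k q w) = ((redWord cs w).map (heckeOp cs k q)).prod := by
      rw [stdT, map_list_prod, List.map_map]
      congr 2
      exact funext hΨ
    rwa [e]
  rw [injective_iff_map_eq_zero]
  intro x hx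
  have hmem : x ∈ Submodule.span k (Set.range (stdT cs k q)) := by rw [span_stdT]; trivial
  obtain ⟨c, rfl⟩ := (Finsupp.mem_span_range_iff_exists_finsupp).1 hmem
  rw [linearIndependent_iff] at hind
  have hc : c = 0 := by
    apply hind
    have := LinearMap.congr_fun hx (Finsupp.single (1 : W) (1 : k))
    rw [Finsupp.sum, map_sum] at this
    simpa [Finsupp.linearCombination_apply, Finsupp.sum] using this
  rw [hc, Finsupp.sum_zero_index]

end HeckeBasis

section TwistedDerivations

variable {B : Type*} {M : CoxeterMatrix B} {W : Type*} [Group W] (cs : CoxeterSystem M W)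

/-- The free ring on symbols `D_t`, with central polynomial parameters indexed by the conjugacy
classes adjoined. -/
abbrev ParamAlg (W : Type*) [Group W] : Type _ :=
  AddMonoidAlgebra (FreeRing W) (ConjClasses W →₀ ℕ)

/-- The parameter attached to a conjugacy class. -/
noncomputable def param (c : ConjClasses W) : ParamAlg W :=
  AddMonoidAlgebra.single (Finsupp.single c 1) 1

/-- The symbol `D_t`. -/
noncomputable def symD (t : W) : ParamAlg W := AddMonoidAlgebra.single 0 (FreeRing.of t)

open Classical in
/-- Conjugation by `s_i`, modulo `s_i`-free terms. -/
noncomputable def twistA (i : B) : FreeRing W →+* FreeRing W :=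
  FreeRing.lift fun t =>
    if t = cs.simple i then 1 - FreeRing.of t
    else FreeRing.of (cs.simple i * t * cs.simple i)

open Classical in
/-- The triangular matrix ring homomorphism encoding a twisted derivation. -/
noncomputable def twistMat (i : B) :
    FreeRing W →+* Matrix (Fin 2) (Fin 2) (FreeRing W) :=
  FreeRing.lift fun t =>
    !![twistA cs i (FreeRing.of t), if t = cs.simple i then -1 else 0; 0, FreeRing.of t]

/-- The `twistA`-derivation with `D_{s_i} ↦ -1` and `D_t ↦ 0` for `t ≠ s_i`. -/
noncomputable def derivA (i : B) : FreeRing W →+ FreeRing W where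
  toFun x := twistMat cs i x 0 1
  map_zero' := by simp
  map_add' x y := by simp

lemma twistMat_apply (i : B) (x : FreeRing W) :
    twistMat cs i x 0 0 = twistA cs i x ∧ twistMat cs i x 1 0 = 0 ∧ twistMat cs i x 1 1 = x := by
  induction x using FreeRing.induction_on with
  | hn1 => simp
  | hb t => simp [twistMat]
  | hm x y hx hy => simp [Matrix.mul_apply, Fin.sum_univ_two, hx, hy]
  | ha x y hx hy => simp [hx, hy]

lemma derivA_mul (i : B) (x y : FreeRing W) :
    derivA cs i (x * y) = twistA cs i x * derivA cs i y + derivA cs i x * y := by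
  simp [derivA, Matrix.mul_apply, Fin.sum_univ_two, twistMat_apply]

lemma derivA_one (i : B) : derivA cs i 1 = 0 := by
  simp [derivA]

open Classical in
lemma derivA_of (i : B) (t : W) :
    derivA cs i (FreeRing.of t) = if t = cs.simple i then -1 else 0 := by
  simp [derivA, twistMat]

/-- The extension of `twistA` fixing the parameters. -/
noncomputable def twist (i : B) : ParamAlg W →+* ParamAlg W :=
  AddMonoidAlgebra.mapRingHom _ (twistA cs i)

/-- The extension of `derivA` linear in the parameters. -/
noncomputable def skewDeriv (i : B) : ParamAlg W →+ ParamAlg W where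
  toFun := AddMonoidAlgebra.map (derivA cs i)
  map_zero' := by ext; simp
  map_add' x y := by ext; simp

/-- The homomorphism killing the symbols `D_t`. -/
noncomputable def counitA : FreeRing W →+* ℤ := FreeRing.lift fun _ => 0

/-- The extension of `counitA` linear in the parameters. -/
noncomputable def counitP : ParamAlg W →+* AddMonoidAlgebra ℤ (ConjClasses W →₀ ℕ) :=
  AddMonoidAlgebra.mapRingHom _ counitA

@[simp] lemma coeff_twist (i : B) (x : ParamAlg W) (m) :
    (twist cs i x).coeff m = twistA cs i (x.coeff m) := by
  simp [twist]

@[simp] lemma coeff_skewDeriv (i : B) (x : ParamAlg W) (m) :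
    (skewDeriv cs i x).coeff m = derivA cs i (x.coeff m) := by
  simp [skewDeriv]

@[simp] lemma coeff_counitP (x : ParamAlg W) (m) :
    (counitP x).coeff m = counitA (x.coeff m) := by
  simp [counitP]

@[simp] lemma twist_single (i : B) (m) (x : FreeRing W) :
    twist cs i (AddMonoidAlgebra.single m x) = AddMonoidAlgebra.single m (twistA cs i x) := by
  simp [twist]

@[simp] lemma skewDeriv_single (i : B) (m) (x : FreeRing W) :
    skewDeriv cs i (AddMonoidAlgebra.single m x) = AddMonoidAlgebra.single m (derivA cs i x) := by
  simp [skewDeriv]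

lemma skewDeriv_mul (i : B) (x y : ParamAlg W) :
    skewDeriv cs i (x * y) = twist cs i x * skewDeriv cs i y + skewDeriv cs i x * y := by
  induction x using AddMonoidAlgebra.induction_linear with
  | zero => simp
  | add x x' hx hx' => simp only [add_mul, map_add, hx, hx']; abel
  | single m a =>
    induction y using AddMonoidAlgebra.induction_linear with
    | zero => simp
    | add y y' hy hy' => simp only [mul_add, map_add, hy, hy']; abel
    | single n b =>
      simp [AddMonoidAlgebra.single_mul_single, derivA_mul, AddMonoidAlgebra.single_add]

lemma skewDeriv_one (i : B) : skewDeriv cs i 1 = 0 := by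
  simp [AddMonoidAlgebra.one_def, derivA_one]

@[simp] lemma twist_param (i : B) (c : ConjClasses W) : twist cs i (param c) = param c := by
  simp [param]

@[simp] lemma skewDeriv_param (i : B) (c : ConjClasses W) : skewDeriv cs i (param c) = 0 := by
  simp [param, derivA_one]

lemma twist_symD_simple (i : B) :
    twist cs i (symD (cs.simple i)) = 1 - symD (cs.simple i) := by
  simp [symD, twistA, AddMonoidAlgebra.one_def, AddMonoidAlgebra.single_sub]

lemma twist_symD {i : B} {t : W} (h : t ≠ cs.simple i) :
    twist cs i (symD t) = symD (cs.simple i * t * cs.simple i) := by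
  simp [symD, twistA, h]

lemma skewDeriv_symD_simple (i : B) : skewDeriv cs i (symD (cs.simple i)) = -1 := by
  simp [symD, derivA_of, AddMonoidAlgebra.one_def, AddMonoidAlgebra.single_neg]

lemma skewDeriv_symD {i : B} {t : W} (h : t ≠ cs.simple i) : skewDeriv cs i (symD t) = 0 := by
  simp [symD, derivA_of, h]

@[simp] lemma counitP_symD (t : W) : counitP (symD t) = 0 := by
  simp [counitP, symD, counitA]

lemma commute_param (c : ConjClasses W) (x : ParamAlg W) : Commute (param c) x :=
  AddMonoidAlgebra.single_commute (fun _ => AddCommute.all _ _) (fun _ => Commute.one_left _) x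

lemma eq_zero_of_mul_param {c : ConjClasses W} {x : ParamAlg W} (h : x * param c = 0) : x = 0 := by
  ext m : 2
  have hcoeff := congrArg (fun y => y.coeff (m + Finsupp.single c 1)) h
  simpa [param] using hcoeff

/-- The products of parameters. -/
noncomputable def paramMonoid (W : Type*) [Group W] : Submonoid (ParamAlg W) :=
  Submonoid.closure (Set.range param)

lemma param_mem (c : ConjClasses W) : param c ∈ paramMonoid W :=
  Submonoid.subset_closure ⟨c, rfl⟩

lemma eq_zero_of_mul_mem {c x : ParamAlg W} (hc : c ∈ paramMonoid W) (h : x * c = 0) : x = 0 := by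
  induction hc using Submonoid.closure_induction generalizing x with
  | mem c hc => obtain ⟨c, rfl⟩ := hc; exact eq_zero_of_mul_param h
  | one => simpa using h
  | mul c d _ _ hc hd => exact hc (hd (by rwa [mul_assoc]))

lemma twist_of_mem (i : B) {c : ParamAlg W} (hc : c ∈ paramMonoid W) : twist cs i c = c := by
  induction hc using Submonoid.closure_induction with
  | mem c hc => obtain ⟨c, rfl⟩ := hc; simp
  | one => simp
  | mul c d _ _ hc hd => simp [hc, hd]

lemma skewDeriv_mul_of_mem (i : B) (x : ParamAlg W) {c : ParamAlg W} (hc : c ∈ paramMonoid W) :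
    skewDeriv cs i (x * c) = skewDeriv cs i x * c := by
  have : skewDeriv cs i c = 0 := by
    induction hc using Submonoid.closure_induction with
    | mem c hc => obtain ⟨c, rfl⟩ := hc; simp
    | one => exact skewDeriv_one cs i
    | mul c d _ _ hc hd => simp [skewDeriv_mul, hc, hd]
  rw [skewDeriv_mul, this, mul_zero, zero_add]

end TwistedDerivations

section RegularModule

variable {B : Type*} {M : CoxeterMatrix B} {W : Type*} [Group W] (cs : CoxeterSystem M W)

/-- The parameter of a simple reflection. -/
noncomputable def simpleParam (i : B) : ParamAlg W := param (ConjClasses.mk (cs.simple i))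

open Classical in
/-- The value of right multiplication by `s_j + (1 - q_j) D_j` on `w`. -/
noncomputable def rightVal (j : B) (w : W) : W →₀ ParamAlg W :=
  if cs.length (w * cs.simple j) < cs.length w then
    Finsupp.single (w * cs.simple j) (simpleParam cs j) +
      Finsupp.single w ((1 - simpleParam cs j) * (1 - symD (w * cs.simple j * w⁻¹)))
  else
    Finsupp.single (w * cs.simple j) 1 +
      Finsupp.single w ((1 - simpleParam cs j) * symD (w * cs.simple j * w⁻¹))

/-- Right multiplication by `s_j + (1 - q_j) D_j`. -/
noncomputable def rightMul (j : B) : (W →₀ ParamAlg W) →ₗ[ParamAlg W] (W →₀ ParamAlg W) :=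
  Finsupp.linearCombination _ (rightVal cs j)

open Classical in
/-- The twist coefficient: `q_i` at left descents, and `1` otherwise. -/
noncomputable def leftCoeff (i : B) (w : W) : ParamAlg W :=
  if cs.length (cs.simple i * w) < cs.length w then simpleParam cs i else 1

/-- The part of left multiplication by `s_i` which is semilinear with respect to `twist`. -/
noncomputable def leftTwist (i : B) : (W →₀ ParamAlg W) →+ (W →₀ ParamAlg W) :=
  Finsupp.liftAddHom fun w =>
    (Finsupp.singleAddHom (cs.simple i * w)).comp
      ((AddMonoidHom.mulRight (leftCoeff cs i w)).comp (twist cs i : ParamAlg W →+ ParamAlg W))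

/-- The remaining part of left multiplication by `s_i`. -/
noncomputable def leftDeriv (i : B) : (W →₀ ParamAlg W) →+ (W →₀ ParamAlg W) :=
  Finsupp.liftAddHom fun w =>
    (Finsupp.singleAddHom w).comp (skewDeriv cs i) +
    (Finsupp.singleAddHom (cs.simple i * w)).comp
      ((AddMonoidHom.mulRight (1 - leftCoeff cs i w)).comp
        (twist cs i : ParamAlg W →+ ParamAlg W))

@[simp] lemma rightMul_single (j : B) (w : W) (x : ParamAlg W) :
    rightMul cs j (Finsupp.single w x) = x • rightVal cs j w := by
  simp [rightMul]

@[simp] lemma leftTwist_single (i : B) (w : W) (x : ParamAlg W) :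
    leftTwist cs i (Finsupp.single w x) =
      Finsupp.single (cs.simple i * w) (twist cs i x * leftCoeff cs i w) := by
  simp [leftTwist]

@[simp] lemma leftDeriv_single (i : B) (w : W) (x : ParamAlg W) :
    leftDeriv cs i (Finsupp.single w x) = Finsupp.single w (skewDeriv cs i x) +
      Finsupp.single (cs.simple i * w) (twist cs i x * (1 - leftCoeff cs i w)) := by
  simp [leftDeriv]

lemma leftTwist_smul (i : B) (y : ParamAlg W) (n : W →₀ ParamAlg W) :
    leftTwist cs i (y • n) = twist cs i y • leftTwist cs i n := by
  induction n using Finsupp.induction_linear with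
  | zero => simp
  | add m n hm hn => simp only [smul_add, map_add, hm, hn]
  | single w x => simp [mul_assoc, -Finsupp.single_mul]

lemma leftDeriv_smul (i : B) (y : ParamAlg W) (n : W →₀ ParamAlg W) :
    leftDeriv cs i (y • n) = skewDeriv cs i y • n + twist cs i y • leftDeriv cs i n := by
  induction n using Finsupp.induction_linear with
  | zero => simp
  | add m n hm hn => simp only [smul_add, map_add, hm, hn]; abel
  | single w x =>
    simp only [Finsupp.smul_single, smul_eq_mul, leftDeriv_single, skewDeriv_mul, map_mul,
      Finsupp.single_add, smul_add, mul_assoc]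
    abel

lemma commute_simpleParam (j : B) (x : ParamAlg W) : Commute (simpleParam cs j) x :=
  commute_param _ x

lemma commute_leftCoeff (i : B) (w : W) (x : ParamAlg W) : Commute (leftCoeff cs i w) x := by
  unfold leftCoeff
  split_ifs
  exacts [commute_simpleParam cs i x, Commute.one_left x]

lemma leftCoeff_mem (i : B) (w : W) : leftCoeff cs i w ∈ paramMonoid W := by
  unfold leftCoeff
  split_ifs
  exacts [param_mem _, one_mem _]

@[simp] lemma twist_simpleParam (i j : B) : twist cs i (simpleParam cs j) = simpleParam cs j :=
  twist_param cs i _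

@[simp] lemma skewDeriv_simpleParam_mul (i j : B) (x : ParamAlg W) :
    skewDeriv cs i (simpleParam cs j * x) = simpleParam cs j * skewDeriv cs i x := by
  rw [skewDeriv_mul, twist_simpleParam]
  simp [simpleParam]

lemma length_simple_mul_mul_simple_lt_iff {i j : B} {w : W}
    (h : w * cs.simple j * w⁻¹ ≠ cs.simple i) :
    cs.length (cs.simple i * (w * cs.simple j)) < cs.length (w * cs.simple j) ↔
      cs.length (cs.simple i * w) < cs.length w := by
  have : ¬ cs.length (w⁻¹ * cs.simple i * w * cs.simple j) < cs.length (cs.simple j) :=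
    not_length_mul_simple_lt fun e => h (by rw [← e]; group)
  rw [length_reflection_mul_mul_lt_iff _ (cs.isReflection_simple i)]
  simp only [Xor, this, not_false_eq_true, and_true, false_and, or_false]

lemma length_simple_mul_mul_simple_lt_iff' {i j : B} {w : W}
    (h : w * cs.simple j * w⁻¹ ≠ cs.simple i) :
    cs.length (cs.simple i * w * cs.simple j) < cs.length (cs.simple i * w) ↔
      cs.length (w * cs.simple j) < cs.length w := by
  have := length_simple_mul_mul_simple_lt_iff cs (i := j) (j := i) (w := w⁻¹)
    (fun e => h (by rw [← e]; group))
  rw [← cs.length_inv, ← cs.length_inv (cs.simple i * w), ← cs.length_inv (w * cs.simple j),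
    ← cs.length_inv w]
  simpa using this

open Classical in
lemma rightVal_of_conj {i j : B} {w : W} (h : w * cs.simple j * w⁻¹ = cs.simple i) :
    rightVal cs j w = if cs.length (cs.simple i * w) < cs.length w then
      Finsupp.single (cs.simple i * w) (simpleParam cs i) +
        Finsupp.single w ((1 - simpleParam cs i) * (1 - symD (cs.simple i)))
    else
      Finsupp.single (cs.simple i * w) 1 +
        Finsupp.single w ((1 - simpleParam cs i) * symD (cs.simple i)) := by
  have e : w * cs.simple j = cs.simple i * w := by rw [← h]; group
  have hp : simpleParam cs j = simpleParam cs i := by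
    rw [simpleParam, simpleParam, ConjClasses.mk_eq_mk_iff_isConj.2]
    exact isConj_iff.2 ⟨w, h⟩
  rw [rightVal, h, e, hp]

open Classical in
lemma rightVal_simple_mul {i j : B} {w : W} (h : w * cs.simple j * w⁻¹ ≠ cs.simple i) :
    rightVal cs j (cs.simple i * w) = if cs.length (w * cs.simple j) < cs.length w then
      Finsupp.single (cs.simple i * (w * cs.simple j)) (simpleParam cs j) +
        Finsupp.single (cs.simple i * w)
          ((1 - simpleParam cs j) *
            (1 - symD (cs.simple i * (w * cs.simple j * w⁻¹) * cs.simple i)))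
    else
      Finsupp.single (cs.simple i * (w * cs.simple j)) 1 +
        Finsupp.single (cs.simple i * w)
          ((1 - simpleParam cs j) *
            symD (cs.simple i * (w * cs.simple j * w⁻¹) * cs.simple i)) := by
  rw [rightVal, if_congr (length_simple_mul_mul_simple_lt_iff' cs h) rfl rfl]
  simp only [mul_assoc, mul_inv_rev, cs.inv_simple]

lemma leftCoeff_mul_simple {i j : B} {w : W} (h : w * cs.simple j * w⁻¹ ≠ cs.simple i) :
    leftCoeff cs i (w * cs.simple j) = leftCoeff cs i w := by
  rw [leftCoeff, if_congr (length_simple_mul_mul_simple_lt_iff cs h) rfl rfl, leftCoeff]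

lemma conj_simple_mul {i j : B} {w : W} (h : w * cs.simple j * w⁻¹ = cs.simple i) :
    cs.simple i * w * cs.simple j * (cs.simple i * w)⁻¹ = cs.simple i := by
  have : cs.simple i * (w * cs.simple j * w⁻¹) * cs.simple i = cs.simple i := by simp [h]
  simpa [mul_assoc] using this

lemma leftTwist_rightVal (i j : B) (w : W) : leftTwist cs i (rightVal cs j w) =
    leftCoeff cs i w • rightVal cs j (cs.simple i * w) := by
  by_cases h : w * cs.simple j * w⁻¹ = cs.simple i
  · rw [rightVal_of_conj cs h, rightVal_of_conj cs (conj_simple_mul cs h)]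
    have hl := length_simple_mul_mul_simple_mul_lt_iff cs i w
    by_cases hd : cs.length (cs.simple i * w) < cs.length w
    · rw [if_pos hd, if_neg (by rw [hl]; exact not_not.2 hd), map_add, leftTwist_single,
        leftTwist_single, leftCoeff, if_neg (by rw [hl]; exact not_not.2 hd), leftCoeff, if_pos hd,
        cs.simple_mul_simple_cancel_left]
      simp only [smul_add, Finsupp.smul_single, smul_eq_mul, map_mul, map_sub, map_one,
        twist_simpleParam, twist_symD_simple, sub_sub_cancel, mul_one]
      rw [(commute_simpleParam cs i (_ * _)).eq]
    · rw [if_neg hd, if_pos (hl.2 hd), map_add, leftTwist_single,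
        leftTwist_single, leftCoeff, if_pos (hl.2 hd), leftCoeff, if_neg hd,
        cs.simple_mul_simple_cancel_left]
      simp only [smul_add, Finsupp.smul_single, smul_eq_mul, map_mul, map_sub, map_one,
        twist_simpleParam, twist_symD_simple, one_mul, mul_one]
  · rw [rightVal_simple_mul cs h, rightVal]
    split_ifs with hd
    all_goals
      simp only [map_add, leftTwist_single, smul_add, Finsupp.smul_single, smul_eq_mul, map_mul,
        map_sub, map_one, twist_simpleParam, twist_symD cs h, leftCoeff_mul_simple cs h,
        (commute_leftCoeff cs i w _).eq]

lemma leftDeriv_rightVal (i j : B) (w : W) : leftDeriv cs i (rightVal cs j w) =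
    (1 - leftCoeff cs i w) • rightVal cs j (cs.simple i * w) := by
  have hq : skewDeriv cs i (simpleParam cs j) = 0 := skewDeriv_param cs i _
  by_cases h : w * cs.simple j * w⁻¹ = cs.simple i
  · rw [rightVal_of_conj cs h, rightVal_of_conj cs (conj_simple_mul cs h)]
    have hl := length_simple_mul_mul_simple_mul_lt_iff cs i w
    have hq : skewDeriv cs i (simpleParam cs i) = 0 := skewDeriv_param cs i _
    by_cases hd : cs.length (cs.simple i * w) < cs.length w
    · rw [if_pos hd, if_neg (by rw [hl]; exact not_not.2 hd), map_add, leftDeriv_single,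
        leftDeriv_single, leftCoeff, if_neg (by rw [hl]; exact not_not.2 hd), leftCoeff, if_pos hd,
        cs.simple_mul_simple_cancel_left]
      simp only [smul_add, Finsupp.smul_single, smul_eq_mul, map_mul, map_sub, map_one, sub_mul,
        one_mul, skewDeriv_simpleParam_mul, skewDeriv_one, skewDeriv_symD_simple,
        twist_simpleParam, twist_symD_simple, sub_sub_cancel, hq]
      simp only [mul_sub, sub_mul, mul_one, sub_self, zero_mul, Finsupp.single_zero, zero_add,
        sub_neg_eq_add, mul_assoc, (commute_simpleParam cs i _).eq]
    · rw [if_neg hd, if_pos (hl.2 hd), map_add, leftDeriv_single,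
        leftDeriv_single, leftCoeff, if_pos (hl.2 hd), leftCoeff, if_neg hd,
        cs.simple_mul_simple_cancel_left]
      simp only [map_mul, map_sub, map_one, sub_mul, one_mul, skewDeriv_simpleParam_mul,
        skewDeriv_one, skewDeriv_symD_simple, sub_self, mul_zero, zero_smul, mul_neg_one,
        Finsupp.single_sub, Finsupp.single_neg, Finsupp.single_zero]
      abel
  · rw [rightVal_simple_mul cs h, rightVal]
    have hc : ∀ x, x * (1 - leftCoeff cs i w) = (1 - leftCoeff cs i w) * x := fun x => by
      rw [mul_sub, sub_mul, (commute_leftCoeff cs i w _).eq, mul_one, one_mul]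
    split_ifs with hd
    all_goals
      simp only [map_add, leftDeriv_single, smul_add, Finsupp.smul_single, smul_eq_mul, map_mul,
        map_sub, map_one, twist_simpleParam, twist_symD cs h, leftCoeff_mul_simple cs h, hc,
        skewDeriv_one, sub_mul, one_mul, skewDeriv_simpleParam_mul, skewDeriv_symD cs h, hq,
        mul_zero, sub_zero, Finsupp.single_zero, zero_add]

end RegularModule

section WordOperators

variable {B : Type*} {M : CoxeterMatrix B} {W : Type*} [Group W] (cs : CoxeterSystem M W)

lemma leftTwist_rightMul (i j : B) (n : W →₀ ParamAlg W) :
    leftTwist cs i (rightMul cs j n) = rightMul cs j (leftTwist cs i n) := by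
  induction n using Finsupp.induction_linear with
  | zero => simp
  | add m n hm hn => simp only [map_add, hm, hn]
  | single w x =>
    rw [rightMul_single, leftTwist_smul, leftTwist_rightVal, leftTwist_single, rightMul_single,
      smul_smul]

lemma leftDeriv_rightMul (i j : B) (n : W →₀ ParamAlg W) :
    leftDeriv cs i (rightMul cs j n) = rightMul cs j (leftDeriv cs i n) := by
  induction n using Finsupp.induction_linear with
  | zero => simp
  | add m n hm hn => simp only [map_add, hm, hn]
  | single w x =>
    rw [rightMul_single, leftDeriv_smul, leftDeriv_rightVal, leftDeriv_single, map_add,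
      rightMul_single, rightMul_single, smul_smul]

lemma leftTwist_apply (i : B) (n : W →₀ ParamAlg W) (w : W) :
    leftTwist cs i n w =
      twist cs i (n (cs.simple i * w)) * leftCoeff cs i (cs.simple i * w) := by
  classical
  induction n using Finsupp.induction_linear with
  | zero => simp
  | add m n hm hn => simp only [map_add, Finsupp.add_apply, add_mul, hm, hn]
  | single v x =>
    rw [leftTwist_single, Finsupp.single_apply, Finsupp.single_apply]
    by_cases h : v = cs.simple i * w
    · simp [h]
    · rw [if_neg h, if_neg (fun e => h (by rw [← e, cs.simple_mul_simple_cancel_left]))]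
      simp

lemma leftDeriv_apply (i : B) (n : W →₀ ParamAlg W) (w : W) :
    leftDeriv cs i n w = skewDeriv cs i (n w) +
      twist cs i (n (cs.simple i * w)) * (1 - leftCoeff cs i (cs.simple i * w)) := by
  classical
  induction n using Finsupp.induction_linear with
  | zero => simp
  | add m n hm hn =>
    simp only [map_add, Finsupp.add_apply, add_mul, hm, hn]
    abel
  | single v x =>
    rw [leftDeriv_single, Finsupp.add_apply, Finsupp.single_apply, Finsupp.single_apply,
      Finsupp.single_apply, Finsupp.single_apply, apply_ite (skewDeriv cs i), map_zero]
    congr 1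
    by_cases h : v = cs.simple i * w
    · simp [h]
    · rw [if_neg h, if_neg (fun e => h (by rw [← e, cs.simple_mul_simple_cancel_left]))]
      simp

/-- The composite of the operators `leftTwist` along a word. -/
noncomputable def leftWord : List B → (W →₀ ParamAlg W) →+ (W →₀ ParamAlg W)
  | [] => AddMonoidHom.id _
  | i :: u => (leftTwist cs i).comp (leftWord u)

/-- The composite of the homomorphisms `twist` along a word. -/
noncomputable def twistWord : List B → ParamAlg W →+* ParamAlg W
  | [] => RingHom.id _
  | i :: u => (twist cs i).comp (twistWord u)

/-- The composite of the operators `rightMul` along a word. -/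
noncomputable def rightWord : List B → (W →₀ ParamAlg W) →ₗ[ParamAlg W] (W →₀ ParamAlg W)
  | [] => LinearMap.id
  | j :: ω => (rightWord ω).comp (rightMul cs j)

lemma rightWord_append_singleton (ω : List B) (j : B) (n : W →₀ ParamAlg W) :
    rightWord cs (ω ++ [j]) n = rightMul cs j (rightWord cs ω n) := by
  induction ω generalizing n with
  | nil => rfl
  | cons i ω ih => exact ih _

lemma leftTwist_rightWord (i : B) (ω : List B) (n : W →₀ ParamAlg W) :
    leftTwist cs i (rightWord cs ω n) = rightWord cs ω (leftTwist cs i n) := by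
  induction ω generalizing n with
  | nil => rfl
  | cons j ω ih => simp [rightWord, ih, leftTwist_rightMul]

lemma leftDeriv_rightWord (i : B) (ω : List B) (n : W →₀ ParamAlg W) :
    leftDeriv cs i (rightWord cs ω n) = rightWord cs ω (leftDeriv cs i n) := by
  induction ω generalizing n with
  | nil => rfl
  | cons j ω ih => simp [rightWord, ih, leftDeriv_rightMul]

lemma leftWord_rightWord (u ω : List B) (n : W →₀ ParamAlg W) :
    leftWord cs u (rightWord cs ω n) = rightWord cs ω (leftWord cs u n) := by
  induction u with
  | nil => rfl
  | cons i u ih => simp [leftWord, ih, leftTwist_rightWord]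

lemma leftWord_smul (u : List B) (x : ParamAlg W) (n : W →₀ ParamAlg W) :
    leftWord cs u (x • n) = twistWord cs u x • leftWord cs u n := by
  induction u with
  | nil => rfl
  | cons i u ih => simp [leftWord, twistWord, ih, leftTwist_smul]

lemma exists_leftWord_apply (u : List B) (w : W) : ∃ c ∈ paramMonoid W, ∀ Y : W →₀ ParamAlg W,
    leftWord cs u Y (cs.wordProd u * w) = twistWord cs u (Y w) * c := by
  induction u with
  | nil => exact ⟨1, one_mem _, fun Y => by simp [leftWord, twistWord]⟩
  | cons i u ih =>
    obtain ⟨c, hc, h⟩ := ih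
    refine ⟨c * leftCoeff cs i (cs.wordProd u * w), mul_mem hc (leftCoeff_mem cs i _), fun Y => ?_⟩
    rw [leftWord, twistWord, AddMonoidHom.comp_apply, RingHom.comp_apply, cs.wordProd_cons,
      leftTwist_apply, mul_assoc, cs.simple_mul_simple_cancel_left, h, map_mul,
      twist_of_mem cs i hc, mul_assoc]

lemma not_length_simple_mul_wordProd_lt {i : B} {u : List B} (h : cs.IsReduced (i :: u)) :
    ¬ cs.length (cs.simple i * cs.wordProd u) < cs.length (cs.wordProd u) := by
  have h1 := h.eq
  have h2 := cs.length_wordProd_le u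
  rw [cs.wordProd_cons, List.length_cons] at h1
  omega

lemma isReduced_of_cons {i : B} {u : List B} (h : cs.IsReduced (i :: u)) : cs.IsReduced u := by
  simpa using h.drop 1

lemma leftWord_single_one {u : List B} (hu : cs.IsReduced u) :
    leftWord cs u (Finsupp.single 1 1) = Finsupp.single (cs.wordProd u) 1 := by
  induction u with
  | nil => simp [leftWord]
  | cons i u ih =>
    rw [leftWord, AddMonoidHom.comp_apply, ih (isReduced_of_cons cs hu), leftTwist_single,
      leftCoeff, if_neg (not_length_simple_mul_wordProd_lt cs hu),
      cs.wordProd_cons, map_one, one_mul]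

lemma leftDeriv_leftWord_rightWord {j : B} {u : List B} (hu : cs.IsReduced (j :: u))
    (ω : List B) :
    leftDeriv cs j (leftWord cs u (rightWord cs ω (Finsupp.single 1 1))) = 0 := by
  rw [leftWord_rightWord, leftDeriv_rightWord, leftWord_single_one cs (isReduced_of_cons cs hu),
    leftDeriv_single, leftCoeff, if_neg (not_length_simple_mul_wordProd_lt cs hu), skewDeriv_one]
  simp

/-- The combinations of elements of length less than `n` whose coefficients are killed by the
counit. -/
noncomputable def lowerTri (n : ℕ) : Submodule (ParamAlg W) (W →₀ ParamAlg W) where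
  carrier := {f | ∀ w, counitP (f w) = 0 ∧ (n ≤ cs.length w → f w = 0)}
  zero_mem' := by simp
  add_mem' {f g} hf hg w := by
    refine ⟨by simp [(hf w).1, (hg w).1], fun h => by simp [(hf w).2 h, (hg w).2 h]⟩
  smul_mem' x f hf w := by
    refine ⟨by simp [(hf w).1], fun h => by simp [(hf w).2 h]⟩

lemma single_mem_lowerTri {n : ℕ} {w : W} {x : ParamAlg W} (hw : cs.length w < n)
    (hx : counitP x = 0) : Finsupp.single w x ∈ lowerTri cs n := by
  classical
  intro v
  rw [Finsupp.single_apply]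
  split_ifs with h
  · subst h
    exact ⟨hx, fun h => absurd h (by omega)⟩
  · simp

lemma rightMul_mem_lowerTri (j : B) {n : ℕ} {f : W →₀ ParamAlg W} (hf : f ∈ lowerTri cs n) :
    rightMul cs j f ∈ lowerTri cs (n + 1) := by
  rw [rightMul, Finsupp.linearCombination_apply]
  refine Submodule.sum_mem _ fun w hw => ?_
  obtain ⟨h1, h2⟩ := hf w
  have hl : cs.length w < n := by
    by_contra h
    exact Finsupp.mem_support_iff.1 hw (h2 (by omega))
  have hl' : cs.length (w * cs.simple j) < n + 1 := by
    rcases cs.length_mul_simple w j with h | h <;> omega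
  dsimp only
  unfold rightVal
  split_ifs
  all_goals
    rw [smul_add, Finsupp.smul_single, Finsupp.smul_single]
    refine add_mem (single_mem_lowerTri cs hl' ?_) (single_mem_lowerTri cs (by omega) ?_) <;>
    rw [smul_eq_mul, map_mul, h1, zero_mul]

lemma rightWord_sub_mem_lowerTri {ω : List B} (hω : cs.IsReduced ω) :
    rightWord cs ω (Finsupp.single 1 1) - Finsupp.single (cs.wordProd ω) 1 ∈
      lowerTri cs ω.length := by
  induction ω using List.reverseRecOn with
  | nil => simp [rightWord]
  | append_singleton ω j ih =>
    have hω' : cs.IsReduced ω := by simpa using hω.take ω.length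
    have h1 := hω.eq
    rw [cs.wordProd_append, cs.wordProd_singleton, List.length_append, List.length_singleton,
      ← hω'.eq] at h1
    have h := rightMul_mem_lowerTri cs j (ih hω')
    rw [map_sub, rightMul_single, rightVal, if_neg (by omega), one_smul, ← sub_sub,
      Submodule.sub_mem_iff_left] at h
    · rw [cs.wordProd_append, cs.wordProd_singleton, List.length_append, List.length_singleton]
      rwa [rightWord_append_singleton]
    · exact single_mem_lowerTri cs (by rw [hω'.eq]; omega) (by simp)

end WordOperators

section Evaluation

variable {B : Type*} {M : CoxeterMatrix B} {W : Type*} [Group W] {cs : CoxeterSystem M W}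

namespace HopfData

variable (S : HopfData cs)

/-- The homomorphism realizing the symbols `D_t` in `Ĥ(W)`. -/
noncomputable def realize : FreeRing W →+* HW M := FreeRing.lift S.D

lemma realize_mem (x : FreeRing W) : S.realize x ∈ Algebra.adjoin ℤ (Set.range S.D) := by
  induction x using FreeRing.induction_on with
  | hn1 => simp [one_mem]
  | hb t => simpa [realize] using Algebra.subset_adjoin (Set.mem_range_self t)
  | ha x y hx hy => rw [map_add]; exact add_mem hx hy
  | hm x y hx hy => rw [map_mul]; exact mul_mem hx hy

lemma ε_realize (x : FreeRing W) : S.ε (S.realize x) = counitA x := by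
  induction x using FreeRing.induction_on with
  | hn1 => simp
  | hb t => simp [realize, counitA, S.ε_D_eq_zero]
  | ha x y hx hy => simp [hx, hy]
  | hm x y hx hy => simp [hx, hy]

lemma hs_mul_D {i : B} {t : W} (h : t ≠ cs.simple i) :
    hs M i * S.D t = S.D (cs.simple i * t * cs.simple i) * hs M i := by
  rw [← S.D_conj i t h, mul_assoc _ (hs M i), hs_mul_self, mul_one]

lemma hs_mul_realize (i : B) (x : FreeRing W) : hs M i * S.realize x =
    S.realize (twistA cs i x) * hs M i + S.realize (derivA cs i x) := by
  induction x using FreeRing.induction_on with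
  | hn1 =>
    simp only [map_neg, map_one, derivA_one, neg_zero, map_zero, add_zero]
    exact (mul_neg_one (hs M i)).trans (neg_one_mul (hs M i)).symm
  | hb t =>
    by_cases h : t = cs.simple i
    · subst h
      have := hs_mul_hD_add M i
      simp only [realize, derivA_of, twistA, FreeRing.lift_of, if_true, map_sub, map_one, map_neg,
        S.D_simple, sub_mul, one_mul]
      rw [← sub_eq_iff_eq_add.2 this.symm]
      abel
    · simp [realize, derivA_of, twistA, h, S.hs_mul_D h]
  | ha x y hx hy =>
    simp only [map_add, mul_add, add_mul, hx, hy]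
    abel
  | hm x y hx hy =>
    rw [map_mul, ← mul_assoc, hx, add_mul, mul_assoc, hy, derivA_mul]
    simp only [map_add, map_mul, mul_add, mul_assoc, add_assoc]

lemma π_mul_realize {y : ParamAlg W}
    (hy : ∀ j u, cs.IsReduced (j :: u) → skewDeriv cs j (twistWord cs u y) = 0)
    {u : List B} (hu : cs.IsReduced u) (m) :
    (S.π (cs.wordProd u) : HW M) * S.realize (y.coeff m) =
      S.realize ((twistWord cs u y).coeff m) * (S.π (cs.wordProd u) : HW M) := by
  induction u with
  | nil => simp [twistWord]
  | cons i u ih =>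
    have h : derivA cs i ((twistWord cs u y).coeff m) = 0 := by
      rw [← coeff_skewDeriv, hy i u hu]
      simp
    rw [cs.wordProd_cons, map_mul, Units.val_mul, S.π_simple, mul_assoc,
      ih (isReduced_of_cons cs hu), ← mul_assoc, hs_mul_realize, h, map_zero, add_zero, mul_assoc,
      twistWord, RingHom.comp_apply, coeff_twist]

lemma realize_mem_K {y : ParamAlg W}
    (hy : ∀ j u, cs.IsReduced (j :: u) → skewDeriv cs j (twistWord cs u y) = 0) (m) :
    S.realize (y.coeff m) ∈ S.K := by
  intro w
  have h := S.π_mul_realize hy (isReduced_redWord cs w) m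
  rw [wordProd_redWord] at h
  rw [h, mul_assoc, Units.mul_inv, mul_one]
  exact S.realize_mem _

lemma π_mul_hD_of_isReduced {j : B} {u : List B} (h : cs.IsReduced (u ++ [j])) :
    (S.π (cs.wordProd u) : HW M) * hD M j =
      S.D (cs.wordProd u * cs.simple j * (cs.wordProd u)⁻¹) * (S.π (cs.wordProd u) : HW M) := by
  induction u with
  | nil => simp [S.D_simple]
  | cons i u ih =>
    have hne : cs.wordProd u * cs.simple j * (cs.wordProd u)⁻¹ ≠ cs.simple i := by
      intro e
      have h1 := h.eq
      have h2 := cs.length_wordProd_le u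
      rw [List.cons_append, cs.wordProd_cons, cs.wordProd_append, cs.wordProd_singleton,
        mul_inv_eq_iff_eq_mul.1 e, cs.simple_mul_simple_cancel_left] at h1
      simp at h1
      omega
    rw [cs.wordProd_cons, map_mul, Units.val_mul, S.π_simple, mul_assoc,
      ih (isReduced_of_cons cs h), ← mul_assoc, S.hs_mul_D hne, mul_assoc]
    simp [mul_assoc]

lemma π_mul_hD {j : B} {w : W} (h : ¬ cs.length (w * cs.simple j) < cs.length w) :
    (S.π w : HW M) * hD M j = S.D (w * cs.simple j * w⁻¹) * (S.π w : HW M) := by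
  have := S.π_mul_hD_of_isReduced (j := j) (u := redWord cs w) (by
    rw [CoxeterSystem.IsReduced, cs.wordProd_append, cs.wordProd_singleton, wordProd_redWord,
      List.length_append, length_redWord, List.length_singleton]
    rcases cs.length_mul_simple w j with h | h <;> omega)
  rwa [wordProd_redWord] at this

lemma π_mul_hD_of_lt {j : B} {w : W} (h : cs.length (w * cs.simple j) < cs.length w) :
    (S.π w : HW M) * hD M j = (S.π w : HW M) - (S.π (w * cs.simple j) : HW M) -
      S.D (w * cs.simple j * w⁻¹) * (S.π w : HW M) := by
  have h1 := S.π_mul_hD (j := j) (w := w * cs.simple j)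
    (by rw [cs.simple_mul_simple_cancel_right]; omega)
  have h2 := hs_mul_hD_add M j
  have e : (S.π w : HW M) = (S.π (w * cs.simple j) : HW M) * hs M j := by
    rw [← S.π_simple, ← Units.val_mul, ← map_mul, cs.simple_mul_simple_cancel_right]
  have e' : w * cs.simple j * cs.simple j * (w * cs.simple j)⁻¹ = w * cs.simple j * w⁻¹ := by
    simp [mul_assoc]
  rw [e'] at h1
  rw [e, ← mul_assoc, ← h1, mul_assoc, mul_assoc, eq_sub_of_add_eq h2, mul_sub, mul_sub, mul_one]

end HopfData

end Evaluation

section BraidRelations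

variable {B : Type*} {M : CoxeterMatrix B} {W : Type*} [Group W] {cs : CoxeterSystem M W}
  (S : HopfData cs) {k : Type*} [CommRing k] {R : Type*} [Ring R] [Algebra k R] (f : HW M →+* R)
  (qc : ConjClasses W → k)

/-- The evaluation of monomials in the parameters. -/
noncomputable def monomialEval : Multiplicative (ConjClasses W →₀ ℕ) →* k :=
  AddMonoidHom.toMultiplicativeLeft
    (Finsupp.liftAddHom fun c => multiplesHom (Additive k) (Additive.ofMul (qc c)))

namespace HopfData

/-- The evaluation of the parameters at elements of `k`, and of the symbols `D_t` in `R`. -/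
noncomputable def eval : ParamAlg W →+* R :=
  AddMonoidAlgebra.liftNCRingHom (f.comp S.realize)
    ((algebraMap k R : k →* R).comp (monomialEval qc))
    fun _ _ => (Algebra.commutes _ _).symm

/-- The evaluation of the module of formal combinations of elements of the Coxeter group. -/
noncomputable def evalModule : (W →₀ ParamAlg W) →+ R :=
  Finsupp.liftAddHom fun w =>
    (AddMonoidHom.mulRight (f (S.π w : HW M))).comp (S.eval f qc : ParamAlg W →+ R)

@[simp] lemma eval_single (m) (x : FreeRing W) : S.eval f qc (AddMonoidAlgebra.single m x) =
    f (S.realize x) * algebraMap k R (monomialEval qc (Multiplicative.ofAdd m)) := by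
  exact AddMonoidAlgebra.liftNC_single _ _ _ _

@[simp] lemma eval_simpleParam (i : B) : S.eval f qc (simpleParam cs i) =
    algebraMap k R (qc (ConjClasses.mk (cs.simple i))) := by
  simp [simpleParam, param, monomialEval]

@[simp] lemma eval_symD (t : W) : S.eval f qc (symD t) = f (S.D t) := by
  simp [symD, realize, monomialEval]

@[simp] lemma evalModule_single (w : W) (x : ParamAlg W) :
    S.evalModule f qc (Finsupp.single w x) = S.eval f qc x * f (S.π w : HW M) := by
  simp [evalModule]

lemma evalModule_smul (x : ParamAlg W) (n : W →₀ ParamAlg W) :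
    S.evalModule f qc (x • n) = S.eval f qc x * S.evalModule f qc n := by
  induction n using Finsupp.induction_linear with
  | zero => simp
  | add m n hm hn => simp only [smul_add, map_add, hm, hn, mul_add]
  | single w y =>
    rw [Finsupp.smul_single, evalModule_single, evalModule_single, smul_eq_mul, map_mul, mul_assoc]

/-- The element `s_i + (1 - q_i) D_i` in `R`. -/
noncomputable def heckeGen (i : B) : R :=
  f (hs M i) + algebraMap k R (1 - qc (ConjClasses.mk (cs.simple i))) * f (hD M i)

lemma evalModule_rightVal (j : B) (w : W) : S.evalModule f qc (rightVal cs j w) =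
    f (S.π w : HW M) * heckeGen (cs := cs) f qc j := by
  have e : (S.π (w * cs.simple j) : HW M) = (S.π w : HW M) * hs M j := by
    rw [map_mul, Units.val_mul, S.π_simple]
  rw [heckeGen, mul_add, ← map_mul f, ← mul_assoc, ← Algebra.commutes, mul_assoc, ← map_mul f]
  unfold rightVal
  split_ifs with h
  · rw [S.π_mul_hD_of_lt h, ← e]
    simp only [map_add, evalModule_single, map_mul, map_sub, map_one, eval_simpleParam, eval_symD,
      sub_mul, mul_sub, one_mul, mul_one, mul_assoc]
    abel
  · rw [S.π_mul_hD h, ← e]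
    simp only [map_add, evalModule_single, map_mul, map_sub, map_one, eval_simpleParam, eval_symD,
      one_mul, mul_assoc]

lemma evalModule_rightMul (j : B) (n : W →₀ ParamAlg W) : S.evalModule f qc (rightMul cs j n) =
    S.evalModule f qc n * heckeGen (cs := cs) f qc j := by
  induction n using Finsupp.induction_linear with
  | zero => simp
  | add m n hm hn => simp only [map_add, hm, hn, add_mul]
  | single w x =>
    rw [rightMul_single, evalModule_smul, evalModule_rightVal, evalModule_single, mul_assoc]

lemma evalModule_rightWord (ω : List B) (n : W →₀ ParamAlg W) :
    S.evalModule f qc (rightWord cs ω n) =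
      S.evalModule f qc n * (ω.map (heckeGen (cs := cs) f qc)).prod := by
  induction ω generalizing n with
  | nil => simp [rightWord]
  | cons j ω ih =>
    rw [rightWord, LinearMap.comp_apply, ih, evalModule_rightMul, List.map_cons, List.prod_cons,
      mul_assoc]

variable {f}

lemma eval_eq_zero (hf : ∀ x ∈ S.K, S.ε x = 0 → f x = 0) {y : ParamAlg W} (hy0 : counitP y = 0)
    (hy : ∀ j u, cs.IsReduced (j :: u) → skewDeriv cs j (twistWord cs u y) = 0) :
    S.eval f qc y = 0 := by
  rw [← y.sum_coeff_single, Finsupp.sum, map_sum]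
  refine Finset.sum_eq_zero fun m _ => ?_
  rw [eval_single, hf _ (S.realize_mem_K hy m), zero_mul]
  rw [ε_realize, ← coeff_counitP, hy0]
  rfl

end HopfData

variable {f}

variable (cs) in
/-- The combinations killed by all the operators `leftDeriv j ∘ leftWord u` with `j :: u` reduced;
it contains the images of `1` under right multiplications. -/
noncomputable def annihilated : AddSubgroup (W →₀ ParamAlg W) where
  carrier := {Y | ∀ j u, cs.IsReduced (j :: u) → leftDeriv cs j (leftWord cs u Y) = 0}
  zero_mem' := by simp
  add_mem' hx hy j u h := by rw [map_add, map_add, hx j u h, hy j u h, add_zero]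
  neg_mem' hx j u h := by rw [map_neg, map_neg, hx j u h, neg_zero]

lemma skewDeriv_twistWord_eq_zero {n : ℕ} {Y : W →₀ ParamAlg W} (hY : Y ∈ annihilated cs)
    (hn : Y ∈ lowerTri cs (n + 1)) {w : W} (hw : cs.length w = n) {j : B} {u : List B}
    (h : cs.IsReduced (j :: u)) : skewDeriv cs j (twistWord cs u (Y w)) = 0 := by
  obtain ⟨c, hc, hcY⟩ := exists_leftWord_apply cs u w
  set t := (cs.wordProd u)⁻¹ * cs.simple j * cs.wordProd u with ht
  have htr : cs.IsReflection t := ⟨(cs.wordProd u)⁻¹, j, by rw [inv_inv]⟩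
  have e : cs.simple j * (cs.wordProd u * w) = cs.wordProd u * (t * w) := by
    rw [ht]; group
  have key := DFunLike.congr_fun (hY j u h) (cs.wordProd u * w)
  have hz : twist cs j (leftWord cs u Y (cs.simple j * (cs.wordProd u * w))) *
      (1 - leftCoeff cs j (cs.simple j * (cs.wordProd u * w))) = 0 := by
    by_cases hl : cs.length (t * w) < cs.length w
    · rw [← length_conj_lt_iff cs (cs.isReflection_simple j) _ _
        (not_length_simple_mul_wordProd_lt cs h)] at hl
      rw [leftCoeff, if_neg, sub_self, mul_zero]
      rw [length_simple_mul_mul_simple_mul_lt_iff, not_not]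
      exact hl
    · obtain ⟨c', -, hc'⟩ := exists_leftWord_apply cs u (t * w)
      have := htr.length_mul_right_ne w
      rw [e, hc', (hn (t * w)).2 (by omega), map_zero, zero_mul, map_zero, zero_mul]
  rw [leftDeriv_apply, hz, add_zero, hcY, skewDeriv_mul_of_mem cs j _ hc] at key
  exact eq_zero_of_mul_mem hc key

lemma rightWord_mem_annihilated (ω : List B) :
    rightWord cs ω (Finsupp.single 1 1) ∈ annihilated cs :=
  fun _ _ h => leftDeriv_leftWord_rightWord cs h ω

lemma smul_mem_annihilated {x : ParamAlg W} {Z : W →₀ ParamAlg W} (hZ : Z ∈ annihilated cs)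
    (hx : ∀ j u, cs.IsReduced (j :: u) → skewDeriv cs j (twistWord cs u x) = 0) :
    x • Z ∈ annihilated cs := fun j u h => by
  rw [leftWord_smul, leftDeriv_smul, hx j u h, hZ j u h, zero_smul, smul_zero, add_zero]

open Classical in
/-- The leading term of a combination, expanded in the basis obtained by right multiplications. -/
noncomputable def leadingTerm (cs : CoxeterSystem M W) (n : ℕ) (Y : W →₀ ParamAlg W) :
    W →₀ ParamAlg W :=
  ∑ w ∈ Y.support with cs.length w = n, Y w • rightWord cs (redWord cs w) (Finsupp.single 1 1)

lemma sub_leadingTerm_mem_lowerTri {n : ℕ} {Y : W →₀ ParamAlg W} (hn : Y ∈ lowerTri cs (n + 1)) :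
    Y - leadingTerm cs n Y ∈ lowerTri cs n := by
  classical
  have h1 : leadingTerm cs n Y - Y.filter (fun w => cs.length w = n) ∈ lowerTri cs n := by
    rw [leadingTerm, ← Finsupp.sum_single (Y.filter _), Finsupp.sum, Finsupp.support_filter,
      ← Finset.sum_sub_distrib]
    refine Submodule.sum_mem _ fun w hw => ?_
    obtain ⟨-, hw⟩ := Finset.mem_filter.1 hw
    have h := rightWord_sub_mem_lowerTri cs (isReduced_redWord cs w)
    rw [wordProd_redWord, length_redWord, hw] at h
    rw [Finsupp.filter_apply_pos (fun w => cs.length w = n) _ hw]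
    simpa [smul_sub, -Finsupp.single_mul] using Submodule.smul_mem _ (Y w) h
  have h2 : Y - Y.filter (fun w => cs.length w = n) ∈ lowerTri cs n := by
    intro w
    obtain ⟨h3, h4⟩ := hn w
    by_cases hw : cs.length w = n
    · simp [hw]
    · rw [Finsupp.sub_apply, Finsupp.filter_apply_neg (fun w => cs.length w = n) _ hw, sub_zero]
      exact ⟨h3, fun h => h4 (by omega)⟩
  simpa using sub_mem h2 h1

lemma HopfData.evalModule_eq_zero (hf : ∀ x ∈ S.K, S.ε x = 0 → f x = 0) (n : ℕ)
    {Y : W →₀ ParamAlg W} (hY : Y ∈ annihilated cs) (hn : Y ∈ lowerTri cs n) :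
    S.evalModule f qc Y = 0 := by
  classical
  induction n generalizing Y with
  | zero =>
    have : Y = 0 := Finsupp.ext fun w => (hn w).2 (Nat.zero_le _)
    rw [this, map_zero]
  | succ n ih =>
    have hd : ∀ w ∈ Y.support.filter (fun w => cs.length w = n), ∀ j u, cs.IsReduced (j :: u) →
        skewDeriv cs j (twistWord cs u (Y w)) = 0 := fun w hw _ _ h =>
      skewDeriv_twistWord_eq_zero hY hn (Finset.mem_filter.1 hw).2 h
    have hmem : leadingTerm cs n Y ∈ annihilated cs :=
      sum_mem fun w hw => smul_mem_annihilated (rightWord_mem_annihilated _) (hd w hw)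
    have h := ih (sub_mem hY hmem) (sub_leadingTerm_mem_lowerTri hn)
    have hz : S.evalModule f qc (leadingTerm cs n Y) = 0 := by
      rw [leadingTerm, map_sum]
      refine Finset.sum_eq_zero fun w hw => ?_
      rw [evalModule_smul, S.eval_eq_zero qc hf (hn w).1 (hd w hw), zero_mul]
    rwa [map_sub, hz, sub_zero] at h

lemma HopfData.prod_heckeGen_eq (hf : ∀ x ∈ S.K, S.ε x = 0 → f x = 0) {ω ω' : List B}
    (hω : cs.IsReduced ω) (hω' : cs.IsReduced ω') (h : cs.wordProd ω = cs.wordProd ω') :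
    (ω.map (heckeGen (cs := cs) f qc)).prod = (ω'.map (heckeGen (cs := cs) f qc)).prod := by
  have hl : ω.length = ω'.length := by rw [← hω.eq, h, hω'.eq]
  have h1 := rightWord_sub_mem_lowerTri cs hω
  have h2 := rightWord_sub_mem_lowerTri cs hω'
  rw [h, hl] at h1
  have h3 := S.evalModule_eq_zero qc hf _
    (sub_mem (rightWord_mem_annihilated ω) (rightWord_mem_annihilated ω'))
    (by simpa using sub_mem h1 h2)
  simpa [sub_eq_zero, evalModule_rightWord] using h3

end BraidRelations

section HeckeHom

variable {B : Type*} {M : CoxeterMatrix B} {W : Type*} [Group W] (cs : CoxeterSystem M W)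

lemma eq_of_isConj_simple {α : Type*} {q : B → α} (hq : ∀ i j : B, Odd (M i j) → q i = q j)
    {i j : B} (h : IsConj (cs.simple i) (cs.simple j)) : q i = q j := by
  classical
  have hl : M.IsLiftable (fun l => if q l = q i then (-1 : ℤˣ) else 1) := by
    intro a b
    rcases Nat.even_or_odd (M a b) with he | ho
    · obtain ⟨m, hm⟩ := he
      rw [hm, ← two_mul, pow_mul, Int.units_sq, one_pow]
    · simp only [hq a b ho, ← sq, Int.units_sq, one_pow]
  have h' := isConj_iff_eq.1 ((cs.lift ⟨_, hl⟩).map_isConj h)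
  rw [cs.lift_apply_simple hl, cs.lift_apply_simple hl, if_pos rfl] at h'
  by_contra hne
  rw [if_neg (Ne.symm hne)] at h'
  exact absurd h' (by decide)

open Classical in
/-- The extension to conjugacy classes of a function on simple reflections. -/
noncomputable def classParam {k : Type*} [Zero k] (q : B → k) (c : ConjClasses W) : k :=
  if h : ∃ i, ConjClasses.mk (cs.simple i) = c then q h.choose else 0

lemma classParam_mk {k : Type*} [Zero k] {q : B → k} (hq : ∀ i j : B, Odd (M i j) → q i = q j)
    (i : B) : classParam cs q (ConjClasses.mk (cs.simple i)) = q i := by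
  have h : ∃ j, ConjClasses.mk (cs.simple j) = ConjClasses.mk (cs.simple i) := ⟨i, rfl⟩
  rw [classParam, dif_pos h]
  exact eq_of_isConj_simple cs hq (ConjClasses.mk_eq_mk_iff_isConj.1 h.choose_spec)

lemma heckeGen_quadratic {k : Type*} [CommRing k] {R : Type*} [Ring R] [Algebra k R]
    (f : HW M →+* R) (c : k) (i : B) :
    (f (hs M i) + algebraMap k R (1 - c) * f (hD M i)) *
        (f (hs M i) + algebraMap k R (1 - c) * f (hD M i)) =
      algebraMap k R (1 - c) * (f (hs M i) + algebraMap k R (1 - c) * f (hD M i)) +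
        algebraMap k R c := by
  have h1 := congrArg f (hs_mul_self M i)
  have h2 := congrArg f (hD_mul_self M i)
  have h3 := congrArg f (eq_sub_of_add_eq (hs_mul_hD_add M i))
  rw [map_mul] at h1 h2
  rw [map_mul, map_sub, map_sub, map_mul] at h3
  simp only [map_one] at h1 h3
  simp only [← Algebra.smul_def]
  rw [Algebra.algebraMap_eq_smul_one]
  simp only [add_mul, mul_add, mul_smul_comm, smul_mul_assoc, h1, h2, h3]
  module

lemma HopfData.exists_heckeHom {cs : CoxeterSystem M W} (S : HopfData cs) {k : Type*} [CommRing k]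
    {R : Type*} [Ring R] [Algebra k R] (f : HW M →+* R) {q : B → k}
    (hq : ∀ i j : B, Odd (M i j) → q i = q j) (hf : ∀ x ∈ S.K, S.ε x = 0 → f x = 0) :
    ∃ φ : HqW k M q →ₐ[k] R,
      ∀ i, φ (tW k M q i) = f (hs M i) + algebraMap k R (1 - q i) * f (hD M i) := by
  set τ : B → R := fun i => f (hs M i) + algebraMap k R (1 - q i) * f (hD M i) with hτ
  have hτ' : heckeGen (cs := cs) f (classParam cs q) = τ := by
    funext i
    rw [heckeGen, classParam_mk cs hq]
  have hrel : ∀ ⦃x y : FreeAlgebra k B⦄, HqRel k M q x y →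
      FreeAlgebra.lift k τ x = FreeAlgebra.lift k τ y := by
    intro x y h
    induction h with
    | quad i =>
      simp only [map_mul, map_add, fT, FreeAlgebra.lift_ι_apply, AlgHom.commutes]
      exact heckeGen_quadratic f (q i) i
    | braid i j hij h0 =>
      have hl : FreeAlgebra.lift k τ ∘ fT k = τ := by
        funext i
        simp [fT]
      rw [altT_eq_prod, altT_eq_prod, map_list_prod, map_list_prod, List.map_map, List.map_map,
        hl, ← hτ']
      refine S.prod_heckeGen_eq _ hf (isReduced_altL cs hij (Or.inr le_rfl))
        (isReduced_altL cs hij.symm (Or.inr (by rw [M.symmetric j i]))) (wordProd_altL_comm cs i j)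
  refine ⟨RingQuot.liftAlgHom k ⟨FreeAlgebra.lift k τ, hrel⟩, fun i => ?_⟩
  simp [tW, fT, hτ]

end HeckeHom

section Lower

variable {B : Type*} (M : CoxeterMatrix B) (π : M.Group →* (HW M)ˣ) (Dfam : Refl M → HW M)
  (ε : HW M →ₐ[ℤ] ℤ)

open Classical in
/-- The extension by zero of a family indexed by reflections. -/
noncomputable def extendRefl (t : M.Group) : HW M :=
  if h : M.toCoxeterSystem.IsReflection t then Dfam ⟨t, h⟩ else 0

lemma adjoin_range_extendRefl :
    Algebra.adjoin ℤ (Set.range (extendRefl M Dfam)) = Algebra.adjoin ℤ (Set.range Dfam) := by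
  apply le_antisymm
  · refine Algebra.adjoin_le ?_
    rintro _ ⟨t, rfl⟩
    rw [extendRefl]
    split_ifs with h
    · exact Algebra.subset_adjoin ⟨_, rfl⟩
    · exact zero_mem _
  · refine Algebra.adjoin_mono ?_
    rintro _ ⟨t, rfl⟩
    exact ⟨t, dif_pos t.2⟩

/-- The data assembled from a family indexed by reflections. -/
noncomputable def hopfData
    (hπ : ∀ i : B, ((π (M.toCoxeterSystem.simple i) : (HW M)ˣ) : HW M) = hs M i)
    (hD1 : ∀ (i : B) (h : M.toCoxeterSystem.IsReflection (M.toCoxeterSystem.simple i)),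
      Dfam ⟨M.toCoxeterSystem.simple i, h⟩ = hD M i)
    (hD2 : ∀ (i : B) (t : Refl M),
      (t : M.Group) ≠ M.toCoxeterSystem.simple i →
      ∀ h : M.toCoxeterSystem.IsReflection
          (M.toCoxeterSystem.simple i * (t : M.Group) * M.toCoxeterSystem.simple i),
        hs M i * Dfam t * hs M i =
          Dfam ⟨M.toCoxeterSystem.simple i * (t : M.Group) * M.toCoxeterSystem.simple i, h⟩)
    (hεD : ∀ i : B, ε (hD M i) = 0) :
    HopfData M.toCoxeterSystem where
  π := π
  π_simple := hπ
  D := extendRefl M Dfam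
  D_eq_zero _ h := dif_neg h
  D_simple i := (dif_pos (M.toCoxeterSystem.isReflection_simple i)).trans (hD1 i _)
  D_conj i t hne := by
    have hiff : M.toCoxeterSystem.IsReflection
        (M.toCoxeterSystem.simple i * t * M.toCoxeterSystem.simple i) ↔
        M.toCoxeterSystem.IsReflection t := by
      have h := M.toCoxeterSystem.isReflection_conj_iff (M.toCoxeterSystem.simple i) t
      rwa [CoxeterSystem.inv_simple] at h
    by_cases ht : M.toCoxeterSystem.IsReflection t
    · rw [extendRefl, extendRefl, dif_pos ht, dif_pos (hiff.2 ht)]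
      exact hD2 i ⟨t, ht⟩ hne _
    · rw [extendRefl, extendRefl, dif_neg ht, dif_neg (mt hiff.1 ht), mul_zero, zero_mul]
  ε := ε
  ε_D := hεD

end Lower

attribute [local instance] Algebra.TensorProduct.rightAlgebra

lemma HopfData.exists_injective_heckeHom {B : Type*} {M : CoxeterMatrix B} {W : Type*} [Group W]
    {cs : CoxeterSystem M W} (S : HopfData cs) {k : Type*} [CommRing k] {q : B → k}
    (hq : ∀ i j : B, Odd (M i j) → q i = q j) (r : HW M → HW M → Prop)
    (hr : ∀ x y, r x y ↔ x ∈ S.K ∧ S.ε x = 0 ∧ y = 0) :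
    ∃ φ : HqW k M q →ₐ[k] (RingQuot r ⊗[ℤ] k),
      (∀ i : B, φ (tW k M q i) = (RingQuot.mkAlgHom ℤ r (hs M i)) ⊗ₜ[ℤ] (1 : k) +
        (RingQuot.mkAlgHom ℤ r (hD M i)) ⊗ₜ[ℤ] (1 - q i)) ∧ Function.Injective φ := by
  let incl : RingQuot r →+* RingQuot r ⊗[ℤ] k := Algebra.TensorProduct.includeLeftRingHom
  have hf : ∀ x ∈ S.K, S.ε x = 0 →
      (incl.comp (RingQuot.mkAlgHom ℤ r : HW M →+* RingQuot r)) x = 0 := fun x hx hε => by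
    have h := RingQuot.mkAlgHom_rel ℤ ((hr x 0).2 ⟨hx, hε, rfl⟩)
    exact (congrArg incl (h.trans (map_zero _))).trans (map_zero _)
  let _ : Ring (RingQuot r ⊗[ℤ] k) := Algebra.semiringToRing ℤ
  obtain ⟨φ, hφ⟩ := S.exists_heckeHom (R := RingQuot r ⊗[ℤ] k)
    (incl.comp (RingQuot.mkAlgHom ℤ r : HW M →+* RingQuot r)) hq hf
  have hφ' : ∀ i : B, φ (tW k M q i) = (RingQuot.mkAlgHom ℤ r (hs M i)) ⊗ₜ[ℤ] (1 : k) +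
      (RingQuot.mkAlgHom ℤ r (hD M i)) ⊗ₜ[ℤ] (1 - q i) := fun i => by
    rw [hφ]
    refine congrArg₂ (· + ·) rfl ?_
    refine (Algebra.TensorProduct.tmul_mul_tmul _ _ _ _).trans ?_
    rw [one_mul, mul_one]
    rfl
  refine ⟨φ, hφ', ?_⟩
  let act : RingQuot r →ₐ[ℤ] Module.End k (W →₀ k) :=
    RingQuot.liftAlgHom ℤ ⟨rep cs k, fun x y h => by
      obtain ⟨hx, hε, rfl⟩ := (hr x y).1 h
      rw [S.rep_eq_zero k hx hε, map_zero]⟩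
  have hact : ∀ x, act (RingQuot.mkAlgHom ℤ r x) = rep cs k x := fun x =>
    RingQuot.liftAlgHom_mkAlgHom_apply _ _ _ _
  let Θ : RingQuot r ⊗[ℤ] k →ₐ[ℤ] Module.End k (W →₀ k) :=
    Algebra.TensorProduct.lift act ((Algebra.ofId k _).restrictScalars ℤ)
      fun x c => (Algebra.commutes c (act x)).symm
  have hΘ : ∀ x c, Θ (x ⊗ₜ[ℤ] c) = act x * algebraMap k _ c := fun x c =>
    Algebra.TensorProduct.lift_tmul _ _ _ _ _
  let Ψ : HqW k M q →ₐ[k] Module.End k (W →₀ k) :=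
    { (Θ : RingQuot r ⊗[ℤ] k →+* _).comp (φ : HqW k M q →+* RingQuot r ⊗[ℤ] k) with
      commutes' := fun c => by
        change Θ (φ (algebraMap k _ c)) = _
        rw [φ.commutes]
        refine (hΘ 1 c).trans ?_
        rw [map_one, one_mul] }
  have hΨ : ∀ i, Ψ (tW k M q i) = heckeOp cs k q i := fun i => by
    change Θ (φ (tW k M q i)) = _
    rw [hφ', map_add, hΘ, hΘ, hact, hact, rep_hs, rep_hD, map_one, mul_one, heckeOp,
      ← Algebra.commutes, ← Algebra.smul_def]
  exact Function.Injective.of_comp (f := Θ) (injective_of_heckeOp cs k q Ψ hΨ)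

/-- **Theorem A.** For any commutative unital ring `k` and any `q = (qᵢ) ∈ kᴵ`
with `qᵢ = qⱼ` whenever `m_{ij}` is odd, the assignment
`Tᵢ ↦ (class of sᵢ + (1 - qᵢ)Dᵢ) ⊗ 1` defines an injective homomorphism of `k`-algebras
`φ : H_q(W) → H̲(W) ⊗_ℤ k`. -/
theorem hecke_embeds_in_lower_HeckeHopf {B : Type*} (M : CoxeterMatrix B)
    (π : M.Group →* (HW M)ˣ)
    (hπ : ∀ i : B, ((π (M.toCoxeterSystem.simple i) : (HW M)ˣ) : HW M) = hs M i)
    (Dfam : Refl M → HW M)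
    (hD1 : ∀ (i : B) (h : M.toCoxeterSystem.IsReflection (M.toCoxeterSystem.simple i)),
      Dfam ⟨M.toCoxeterSystem.simple i, h⟩ = hD M i)
    (hD2 : ∀ (i : B) (t : Refl M),
      (t : M.Group) ≠ M.toCoxeterSystem.simple i →
      ∀ h : M.toCoxeterSystem.IsReflection
          (M.toCoxeterSystem.simple i * (t : M.Group) * M.toCoxeterSystem.simple i),
        hs M i * Dfam t * hs M i =
          Dfam ⟨M.toCoxeterSystem.simple i * (t : M.Group) * M.toCoxeterSystem.simple i, h⟩)
    (ε : HW M →ₐ[ℤ] ℤ)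
    (hεs : ∀ i : B, ε (hs M i) = 1) (hεD : ∀ i : B, ε (hD M i) = 0)
    (k : Type*) [CommRing k] (q : B → k)
    (hq : ∀ i j : B, Odd (M i j) → q i = q j) :
    ∃ φ : HqW k M q →ₐ[k] (HWlow M π Dfam ε ⊗[ℤ] k),
      (∀ i : B,
        φ (tW k M q i) =
          (RingQuot.mkAlgHom ℤ (lowRel M π Dfam ε) (hs M i)) ⊗ₜ[ℤ] (1 : k) +
            (RingQuot.mkAlgHom ℤ (lowRel M π Dfam ε) (hD M i)) ⊗ₜ[ℤ] (1 - q i)) ∧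
      Function.Injective φ := by
  refine (hopfData M π Dfam ε hπ hD1 hD2 hεD).exists_injective_heckeHom hq
    (lowRel M π Dfam ε) fun x y => and_congr_left' ?_
  change _ ↔ ∀ w : M.Group, _ ∈ Algebra.adjoin ℤ (Set.range (extendRefl M Dfam))
  rw [adjoin_range_extendRefl]
  rfl

end HeckeHopfCox
end

section
/- Let W be a Coxeter group with length function ℓ and reflections 𝒮, and let D̂ be the ℤ-algebra presented by generators e_s (s ∈ 𝒮) and relations e_s² = e_s. Then: (a) there is a unique action of the group W on D̂ by ℤ-algebra automorphisms such that for every i ∈ I, s_i(e_{s_i}) = 1 − e_{s_i} and s_i(e_s) = e_{s_i s s_i} for all reflections s ≠ s_i; this action satisfies, for every w ∈ W and s ∈ 𝒮, w(e_s) = e_{w s w⁻¹} if ℓ(w·s) > ℓ(w) and w(e_s) = 1 − e_{w s w⁻¹} if ℓ(w·s) < ℓ(w); and (b) for every reflection s ∈ 𝒮 there exists an additive map d_s : D̂ → D̂ satisfying the twisted Leibniz rule d_s(x·y) = d_s(x)·y + s(x)·d_s(y) for all x, y ∈ D̂ (where s acts via the action from (a)) and d_s(e_{s'}) = δ_{s,s'}·1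 for all s' ∈ 𝒮. -/
open scoped TensorProduct

namespace HeckeHopfCox

noncomputable def fe {B : Type*} (M : CoxeterMatrix B) (t : Refl M) :
    FreeAlgebra ℤ (Refl M) := FreeAlgebra.ι ℤ t

/-- The relations `e_s² = e_s`, `s ∈ 𝒮`. -/
inductive IdemRel {B : Type*} (M : CoxeterMatrix B) :
    FreeAlgebra ℤ (Refl M) → FreeAlgebra ℤ (Refl M) → Prop
  | idem (t : Refl M) : IdemRel M (fe M t * fe M t) (fe M t)

/-- The `ℤ`-algebra presented by generators `e_s`, `s ∈ 𝒮`, and relations `e_s² = e_s`. -/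
abbrev FD {B : Type*} (M : CoxeterMatrix B) : Type _ := RingQuot (IdemRel M)

/-- The image of the generator `e_s` in the presented algebra. -/
noncomputable def eg {B : Type*} (M : CoxeterMatrix B) (t : Refl M) : FD M :=
  RingQuot.mkAlgHom ℤ (IdemRel M) (fe M t)

/-- The condition that a `W`-action `ρ` on `D̂` by algebra automorphisms satisfies
`sᵢ(e_{sᵢ}) = 1 - e_{sᵢ}` and `sᵢ(e_s) = e_{sᵢ s sᵢ}` for `s ≠ sᵢ`. -/
def SimpleActionCond {B : Type*} (M : CoxeterMatrix B)
    (ρ : M.Group →* (FD M ≃ₐ[ℤ] FD M)) : Prop :=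
  ∀ i : B,
    (∀ h : M.toCoxeterSystem.IsReflection (M.toCoxeterSystem.simple i),
      ρ (M.toCoxeterSystem.simple i) (eg M ⟨M.toCoxeterSystem.simple i, h⟩) =
        1 - eg M ⟨M.toCoxeterSystem.simple i, h⟩) ∧
    (∀ t : Refl M, (t : M.Group) ≠ M.toCoxeterSystem.simple i →
      ∀ h : M.toCoxeterSystem.IsReflection
          (M.toCoxeterSystem.simple i * (t : M.Group) * M.toCoxeterSystem.simple i),
        ρ (M.toCoxeterSystem.simple i) (eg M t) =
          eg M ⟨M.toCoxeterSystem.simple i * (t : M.Group) * M.toCoxeterSystem.simple i, h⟩)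

section Conjugation

variable {B : Type*} {M : CoxeterMatrix B} {W : Type*} [Group W] (cs : CoxeterSystem M W)

theorem pow_mul_simple_mul_pow (i j : B) (n : ℕ) :
    (cs.simple i * cs.simple j) ^ n * cs.simple j * (cs.simple i * cs.simple j) ^ n =
      cs.simple j := by
  induction n with
  | zero => simp
  | succ n ih =>
    nth_rw 1 [pow_succ]
    rw [pow_succ']
    simpa [mul_assoc] using ih

theorem conj_pow_eq_simple_iff (i j : B) (n : ℕ) (t : W) :
    (cs.simple i * cs.simple j) ^ n * t * ((cs.simple i * cs.simple j) ^ n)⁻¹ =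
        cs.simple j ↔
      t = cs.simple j * (cs.simple i * cs.simple j) ^ (2 * n) := by
  have h := pow_mul_simple_mul_pow cs i j n
  generalize hc : (cs.simple i * cs.simple j) ^ n = c at h ⊢
  rw [two_mul, pow_add, hc, mul_inv_eq_iff_eq_mul, ← mul_right_inj c (b := t),
    ← mul_assoc, ← mul_assoc, h]

theorem simple_conj_eq_simple_iff (i j : B) (t : W) :
    cs.simple j * t * (cs.simple j)⁻¹ = cs.simple i ↔
      t = cs.simple j * (cs.simple i * cs.simple j) := by
  rw [mul_inv_eq_iff_eq_mul, ← mul_right_inj (cs.simple j) (b := t),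
    cs.simple_mul_simple_cancel_left]

theorem conj_pow_eq_iff_odd (i j : B) (n : ℕ) (t : W) :
    (cs.simple j * ((cs.simple i * cs.simple j) ^ n * t *
        ((cs.simple i * cs.simple j) ^ n)⁻¹) * (cs.simple j)⁻¹ = cs.simple i) ↔
      t = cs.simple j * (cs.simple i * cs.simple j) ^ (2 * n + 1) := by
  rw [simple_conj_eq_simple_iff]
  have h := pow_mul_simple_mul_pow cs i j n
  generalize hd : cs.simple i * cs.simple j = d at h ⊢
  have h2 : d ^ (2 * n + 1) = d ^ n * d * d ^ n := by
    rw [← pow_succ, ← pow_add]; congr 1; ring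
  have h3 : d * d ^ n = d ^ n * d := by rw [← pow_succ, ← pow_succ']
  rw [h2, mul_inv_eq_iff_eq_mul, ← mul_right_inj (d ^ n) (b := t), mul_assoc (d ^ n) d, h3,
    ← mul_assoc, ← mul_assoc, ← mul_assoc, h, mul_assoc, h3, mul_assoc]

end Conjugation

section Action

variable {B : Type*} (M : CoxeterMatrix B)

/-- Conjugation of a reflection by an element of the Coxeter group. -/
def conjRefl (w : M.Group) (t : Refl M) : Refl M :=
  ⟨w * (t : M.Group) * w⁻¹, t.2.conj w⟩

variable {M} in
theorem conjRefl_mul (w w' : M.Group) (t : Refl M) :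
    conjRefl M (w * w') t = conjRefl M w (conjRefl M w' t) :=
  Subtype.ext (by simp [conjRefl, mul_assoc])

variable {M} in
theorem conjRefl_one (t : Refl M) : conjRefl M 1 t = t :=
  Subtype.ext (by simp [conjRefl])

open Classical in
/-- The action of a simple reflection on signed reflections: conjugate the reflection, and
change the sign exactly on the simple reflection itself. -/
noncomputable def signedSimple (i : B) : Function.End (Refl M × ZMod 2) := fun x =>
  (conjRefl M (M.toCoxeterSystem.simple i) x.1,
    x.2 + if (x.1 : M.Group) = M.toCoxeterSystem.simple i then 1 else 0)

open Classical in
theorem signedSimple_mul_pow_apply (i j : B) (n : ℕ) (x : Refl M × ZMod 2) :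
    ((signedSimple M i * signedSimple M j) ^ n) x =
      (conjRefl M ((M.toCoxeterSystem.simple i * M.toCoxeterSystem.simple j) ^ n) x.1,
        x.2 + ∑ k ∈ Finset.range (2 * n),
          if (x.1 : M.Group) =
              M.toCoxeterSystem.simple j *
                (M.toCoxeterSystem.simple i * M.toCoxeterSystem.simple j) ^ k
            then 1 else 0) := by
  induction n with
  | zero =>
    rw [pow_zero, pow_zero, conjRefl_one, mul_zero, Finset.sum_range_zero, add_zero]
    rfl
  | succ n ih =>
    rw [pow_succ']
    change signedSimple M i (signedSimple M j (((signedSimple M i * signedSimple M j) ^ n) x)) = _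
    rw [ih, mul_add, mul_one, Finset.sum_range_succ, Finset.sum_range_succ]
    refine Prod.ext ?_ ?_
    · simp only [signedSimple, ← conjRefl_mul, pow_succ', mul_assoc]
    · simp only [signedSimple, conjRefl, conj_pow_eq_simple_iff, conj_pow_eq_iff_odd, add_assoc]

theorem signedSimple_isLiftable : M.IsLiftable (signedSimple M) := by
  classical
  intro i j
  funext x
  rw [signedSimple_mul_pow_apply, two_mul, Finset.sum_range_add]
  simp only [pow_add, M.toCoxeterSystem.simple_mul_simple_pow, one_mul, conjRefl_one,
    CharTwo.add_self_eq_zero, add_zero]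
  rfl

/-- The action of the Coxeter group on signed reflections. -/
noncomputable def signedAction : M.Group →* Function.End (Refl M × ZMod 2) :=
  M.toCoxeterSystem.lift ⟨signedSimple M, signedSimple_isLiftable M⟩

theorem signedAction_simple (i : B) :
    signedAction M (M.toCoxeterSystem.simple i) = signedSimple M i :=
  M.toCoxeterSystem.lift_apply_simple (signedSimple_isLiftable M) i

theorem signedAction_mul_apply (w w' : M.Group) (x : Refl M × ZMod 2) :
    signedAction M (w * w') x = signedAction M w (signedAction M w' x) := by
  rw [map_mul]; rfl

theorem signedAction_one_apply (x : Refl M × ZMod 2) : signedAction M 1 x = x := by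
  rw [map_one]; rfl

/-- The parity by which `w` changes the sign of the reflection `t`. -/
noncomputable def inversionParity (w : M.Group) (t : Refl M) : ZMod 2 :=
  (signedAction M w (t, 0)).2

theorem signedAction_apply (w : M.Group) (t : Refl M) (z : ZMod 2) :
    signedAction M w (t, z) = (conjRefl M w t, z + inversionParity M w t) := by
  unfold inversionParity
  induction w using M.toCoxeterSystem.simple_induction_left generalizing z with
  | one => simp [signedAction_one_apply, conjRefl_one]
  | mul_simple_left w i ih =>
    rw [signedAction_mul_apply, signedAction_mul_apply, ih z, ih 0, signedAction_simple,
      conjRefl_mul]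
    simp [signedSimple, add_assoc]

theorem inversionParity_one (t : Refl M) : inversionParity M 1 t = 0 := by
  simp [inversionParity, signedAction_one_apply]

theorem inversionParity_mul (w w' : M.Group) (t : Refl M) :
    inversionParity M (w * w') t =
      inversionParity M w' t + inversionParity M w (conjRefl M w' t) := by
  rw [inversionParity, signedAction_mul_apply, signedAction_apply, signedAction_apply, zero_add]

open Classical in
theorem inversionParity_simple (i : B) (t : Refl M) :
    inversionParity M (M.toCoxeterSystem.simple i) t =
      if (t : M.Group) = M.toCoxeterSystem.simple i then 1 else 0 := by
  rw [inversionParity, signedAction_simple, signedSimple, zero_add]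

theorem inversionParity_self (t : Refl M) : inversionParity M t t = 1 := by
  obtain ⟨_, u, i, rfl⟩ := t
  have h : conjRefl M u⁻¹ ⟨u * M.toCoxeterSystem.simple i * u⁻¹, u, i, rfl⟩ =
      ⟨M.toCoxeterSystem.simple i, M.toCoxeterSystem.isReflection_simple i⟩ :=
    Subtype.ext (by simp [conjRefl, mul_assoc])
  have h' : conjRefl M (M.toCoxeterSystem.simple i)
      ⟨M.toCoxeterSystem.simple i, M.toCoxeterSystem.isReflection_simple i⟩ =
      ⟨M.toCoxeterSystem.simple i, M.toCoxeterSystem.isReflection_simple i⟩ :=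
    Subtype.ext (by simp [conjRefl])
  have hu := inversionParity_mul M u u⁻¹ ⟨u * M.toCoxeterSystem.simple i * u⁻¹, u, i, rfl⟩
  rw [mul_inv_cancel, inversionParity_one, h] at hu
  rw [inversionParity_mul, inversionParity_mul, h, h', inversionParity_simple, if_pos rfl,
    add_left_comm, ← hu, add_zero]

theorem mem_rightInvSeq_of_inversionParity_ne_zero (ω : List B) (t : Refl M)
    (h : inversionParity M (M.toCoxeterSystem.wordProd ω) t ≠ 0) :
    (t : M.Group) ∈ M.toCoxeterSystem.rightInvSeq ω := by
  induction ω with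
  | nil => simp [inversionParity_one] at h
  | cons i ω ih =>
    rw [CoxeterSystem.rightInvSeq, List.mem_cons]
    by_cases hω : inversionParity M (M.toCoxeterSystem.wordProd ω) t = 0
    · left
      rw [M.toCoxeterSystem.wordProd_cons, inversionParity_mul, hω, zero_add,
        inversionParity_simple] at h
      have h1 : (M.toCoxeterSystem.wordProd ω) * (t : M.Group) * (M.toCoxeterSystem.wordProd ω)⁻¹ =
          M.toCoxeterSystem.simple i := by
        by_contra h2
        exact h (if_neg h2)
      rw [← h1]
      group
    · exact Or.inr (ih hω)

theorem length_mul_lt_of_inversionParity_ne_zero {w : M.Group} {t : Refl M}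
    (h : inversionParity M w t ≠ 0) :
    M.toCoxeterSystem.length (w * (t : M.Group)) < M.toCoxeterSystem.length w := by
  obtain ⟨ω, hω, rfl⟩ := M.toCoxeterSystem.exists_isReduced w
  exact (M.toCoxeterSystem.isRightInversion_of_mem_rightInvSeq hω
    (mem_rightInvSeq_of_inversionParity_ne_zero M ω t h)).2

theorem inversionParity_eq_zero_of_lt {w : M.Group} {t : Refl M}
    (h : M.toCoxeterSystem.length w < M.toCoxeterSystem.length (w * (t : M.Group))) :
    inversionParity M w t = 0 := by
  by_contra h'
  exact (length_mul_lt_of_inversionParity_ne_zero M h').not_gt h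

theorem inversionParity_eq_one_of_lt {w : M.Group} {t : Refl M}
    (h : M.toCoxeterSystem.length (w * (t : M.Group)) < M.toCoxeterSystem.length w) :
    inversionParity M w t = 1 := by
  have ht : conjRefl M (t : M.Group) t = t := Subtype.ext (by simp [conjRefl])
  have h0 : inversionParity M (w * t) t = 0 := by
    apply inversionParity_eq_zero_of_lt
    rwa [mul_assoc, t.2.mul_self, mul_one]
  rw [inversionParity_mul, inversionParity_self, ht] at h0
  exact (CharTwo.add_eq_zero.mp h0).symm

theorem eg_mul_self (t : Refl M) : eg M t * eg M t = eg M t := by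
  rw [eg, ← map_mul]
  exact RingQuot.mkAlgHom_rel ℤ (IdemRel.idem t)

/-- The algebra homomorphism out of `FD M` determined by a family of idempotents. -/
noncomputable def liftIdem {A : Type*} [Ring A] [Algebra ℤ A] (f : Refl M → A)
    (hf : ∀ t, f t * f t = f t) : FD M →ₐ[ℤ] A :=
  RingQuot.liftAlgHom ℤ ⟨FreeAlgebra.lift ℤ f, by
    rintro _ _ ⟨t⟩
    simpa [fe] using hf t⟩

theorem liftIdem_eg {A : Type*} [Ring A] [Algebra ℤ A] (f : Refl M → A)
    (hf : ∀ t, f t * f t = f t) (t : Refl M) : liftIdem M f hf (eg M t) = f t := by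
  simp [liftIdem, eg, fe]

variable {M} in
theorem algHom_ext_eg {A : Type*} [Ring A] [Algebra ℤ A] {f g : FD M →ₐ[ℤ] A}
    (h : ∀ t, f (eg M t) = g (eg M t)) : f = g := by
  apply RingQuot.ringQuot_ext'
  apply FreeAlgebra.hom_ext
  funext t
  exact h t

variable {M} in
theorem induction_eg {p : FD M → Prop} (algebraMap : ∀ n : ℤ, p (algebraMap ℤ (FD M) n))
    (eg : ∀ t, p (eg M t)) (mul : ∀ x y, p x → p y → p (x * y))
    (add : ∀ x y, p x → p y → p (x + y)) (x : FD M) : p x := by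
  obtain ⟨a, rfl⟩ := RingQuot.mkAlgHom_surjective ℤ (IdemRel M) x
  induction a using FreeAlgebra.induction with
  | grade0 n => rw [AlgHom.commutes]; exact algebraMap n
  | grade1 t => exact eg t
  | mul a b ha hb => rw [map_mul]; exact mul _ _ ha hb
  | add a b ha hb => rw [map_add]; exact add _ _ ha hb

/-- The idempotent attached to a signed reflection: `e_t` or `1 - e_t`. -/
noncomputable def signedIdem (x : Refl M × ZMod 2) : FD M :=
  if x.2 = 0 then eg M x.1 else 1 - eg M x.1

theorem signedIdem_zero (t : Refl M) : signedIdem M (t, 0) = eg M t := if_pos rfl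

theorem signedIdem_one (t : Refl M) : signedIdem M (t, 1) = 1 - eg M t :=
  if_neg one_ne_zero

theorem signedIdem_mul_self (x : Refl M × ZMod 2) :
    signedIdem M x * signedIdem M x = signedIdem M x := by
  have h : IsIdempotentElem (eg M x.1) := eg_mul_self M x.1
  unfold signedIdem
  split_ifs
  · exact h
  · exact h.one_sub

theorem signedIdem_add_one (t : Refl M) (z : ZMod 2) :
    signedIdem M (t, 1 + z) = 1 - signedIdem M (t, z) := by
  obtain rfl | rfl : z = 0 ∨ z = 1 := by revert z; decide
  · rw [add_zero, signedIdem_zero, signedIdem_one]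
  · rw [CharTwo.add_self_eq_zero, signedIdem_zero, signedIdem_one, sub_sub_cancel]

variable {M} in
theorem apply_signedIdem {w : M.Group} {f : FD M →ₐ[ℤ] FD M}
    (hf : ∀ t, f (eg M t) = signedIdem M (signedAction M w (t, 0))) (x : Refl M × ZMod 2) :
    f (signedIdem M x) = signedIdem M (signedAction M w x) := by
  obtain ⟨t, z⟩ := x
  obtain rfl | rfl : z = 0 ∨ z = 1 := by revert z; decide
  · rw [signedIdem_zero, hf]
  · rw [signedIdem_one, map_sub, map_one, hf, signedAction_apply, signedAction_apply, zero_add,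
      signedIdem_add_one]

/-- The algebra endomorphism of `FD M` given by an element of the Coxeter group. -/
noncomputable def actionHom (w : M.Group) : FD M →ₐ[ℤ] FD M :=
  liftIdem M (fun t => signedIdem M (signedAction M w (t, 0))) fun _ => signedIdem_mul_self M _

theorem actionHom_eg (w : M.Group) (t : Refl M) :
    actionHom M w (eg M t) = signedIdem M (signedAction M w (t, 0)) :=
  liftIdem_eg M _ _ t

/-- The action of the Coxeter group on `FD M` by algebra automorphisms. -/
noncomputable def action : M.Group →* (FD M ≃ₐ[ℤ] FD M) :=
  (AlgEquiv.algHomUnitsEquiv ℤ (FD M)).toMonoidHom.comp <| MonoidHom.toHomUnits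
    { toFun := actionHom M
      map_one' := algHom_ext_eg fun t => by
        rw [actionHom_eg, signedAction_one_apply, signedIdem_zero, AlgHom.one_apply]
      map_mul' := fun w w' => algHom_ext_eg fun t => by
        rw [AlgHom.mul_apply, actionHom_eg, actionHom_eg, signedAction_mul_apply,
          apply_signedIdem (actionHom_eg M w)] }

theorem action_eg (w : M.Group) (t : Refl M) :
    action M w (eg M t) = signedIdem M (signedAction M w (t, 0)) :=
  actionHom_eg M w t

theorem simpleActionCond_iff (ρ : M.Group →* (FD M ≃ₐ[ℤ] FD M)) :
    SimpleActionCond M ρ ↔ ∀ i t, ρ (M.toCoxeterSystem.simple i) (eg M t) =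
      signedIdem M (signedAction M (M.toCoxeterSystem.simple i) (t, 0)) := by
  have key (i : B) (t : Refl M) :
      signedIdem M (signedAction M (M.toCoxeterSystem.simple i) (t, 0)) =
        signedIdem M (conjRefl M (M.toCoxeterSystem.simple i) t,
          inversionParity M (M.toCoxeterSystem.simple i) t) := by
    rw [signedAction_apply, zero_add]
  have key_self (i : B) (h : M.toCoxeterSystem.IsReflection (M.toCoxeterSystem.simple i)) :
      signedIdem M
          (signedAction M (M.toCoxeterSystem.simple i) (⟨M.toCoxeterSystem.simple i, h⟩, 0)) =
        1 - eg M ⟨M.toCoxeterSystem.simple i, h⟩ := by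
    rw [key, inversionParity_simple, if_pos rfl, signedIdem_one]
    congr 2
    exact Subtype.ext (by simp [conjRefl])
  have key_ne (i : B) (t : Refl M) (ht : (t : M.Group) ≠ M.toCoxeterSystem.simple i)
      (h : M.toCoxeterSystem.IsReflection
        (M.toCoxeterSystem.simple i * (t : M.Group) * M.toCoxeterSystem.simple i)) :
      signedIdem M (signedAction M (M.toCoxeterSystem.simple i) (t, 0)) =
        eg M ⟨M.toCoxeterSystem.simple i * (t : M.Group) * M.toCoxeterSystem.simple i, h⟩ := by
    rw [key, inversionParity_simple, if_neg ht, signedIdem_zero]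
    congr 1
    exact Subtype.ext (by simp only [conjRefl, M.toCoxeterSystem.inv_simple])
  refine ⟨fun hρ i t => ?_, fun hρ i => ⟨fun h => ?_, fun t ht h => ?_⟩⟩
  · by_cases ht : (t : M.Group) = M.toCoxeterSystem.simple i
    · obtain ⟨t, h⟩ := t
      obtain rfl : t = M.toCoxeterSystem.simple i := ht
      rw [(hρ i).1 h, key_self]
    · have h : M.toCoxeterSystem.IsReflection
          (M.toCoxeterSystem.simple i * (t : M.Group) * M.toCoxeterSystem.simple i) := by
        simpa only [M.toCoxeterSystem.inv_simple] using t.2.conj (M.toCoxeterSystem.simple i)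
      rw [(hρ i).2 t ht h, key_ne i t ht h]
  · rw [hρ, key_self]
  · rw [hρ, key_ne i t ht h]

variable {M} in
theorem SimpleActionCond.apply_eg {ρ : M.Group →* (FD M ≃ₐ[ℤ] FD M)}
    (hρ : SimpleActionCond M ρ) (w : M.Group) (t : Refl M) :
    ρ w (eg M t) = signedIdem M (conjRefl M w t, inversionParity M w t) := by
  rw [simpleActionCond_iff] at hρ
  suffices h : ρ w (eg M t) = signedIdem M (signedAction M w (t, 0)) by
    rw [h, signedAction_apply, zero_add]
  induction w using M.toCoxeterSystem.simple_induction_left with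
  | one => rw [map_one, signedAction_one_apply, signedIdem_zero, AlgEquiv.one_apply]
  | mul_simple_left w i ih =>
    rw [map_mul, AlgEquiv.mul_apply, ih, signedAction_mul_apply]
    exact apply_signedIdem (f := (ρ (M.toCoxeterSystem.simple i) : FD M →ₐ[ℤ] FD M)) (hρ i) _

variable {M} in
theorem SimpleActionCond.apply_eg_self {ρ : M.Group →* (FD M ≃ₐ[ℤ] FD M)}
    (hρ : SimpleActionCond M ρ) (t : Refl M) : ρ t (eg M t) = 1 - eg M t := by
  have ht : conjRefl M (t : M.Group) t = t := Subtype.ext (by simp [conjRefl])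
  rw [hρ.apply_eg, inversionParity_self, signedIdem_one, ht]

/-- A family of values `δ` on the generators compatible with `e_t ^ 2 = e_t` extends to a
`σ`-twisted derivation of `FD M`. -/
theorem exists_twistedDerivation (σ : FD M →ₐ[ℤ] FD M) (δ : Refl M → FD M)
    (hδ : ∀ t, σ (eg M t) * δ t + δ t * eg M t = δ t) :
    ∃ d : FD M →+ FD M, (∀ x y, d (x * y) = d x * y + σ x * d y) ∧ ∀ t, d (eg M t) = δ t := by
  let Φ : FD M →ₐ[ℤ] Matrix (Fin 2) (Fin 2) (FD M) :=
    liftIdem M (fun t => !![σ (eg M t), δ t; 0, eg M t]) fun t => by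
      rw [Matrix.mul_fin_two, hδ, ← map_mul, eg_mul_self]
      simp
  have hΦ_eg (t : Refl M) : Φ (eg M t) = !![σ (eg M t), δ t; 0, eg M t] := liftIdem_eg M _ _ t
  have hΦ (x : FD M) : Φ x 0 0 = σ x ∧ Φ x 1 0 = 0 ∧ Φ x 1 1 = x := by
    induction x using induction_eg with
    | algebraMap n => simp only [AlgHom.commutes, Matrix.algebraMap_matrix_apply]; simp
    | eg t => simp [hΦ_eg]
    | mul x y hx hy => simp [Matrix.mul_apply, Fin.sum_univ_two, hx, hy]
    | add x y hx hy => simp [hx, hy]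
  refine ⟨(Matrix.entryAddMonoidHom (FD M) (0 : Fin 2) (1 : Fin 2)).comp (Φ : FD M →+ _),
    fun x y => ?_, fun t => ?_⟩
  · simp [Matrix.mul_apply, Fin.sum_univ_two, hΦ, add_comm]
  · simp [hΦ_eg]

end Action

/-- Let `W` be a Coxeter group, `𝒮` its reflections and `D̂` the
`ℤ`-algebra presented by generators `e_s` (`s ∈ 𝒮`) with relations `e_s² = e_s`. Then:
(a) there is a unique `W`-action on `D̂` by algebra automorphisms with
`sᵢ(e_{sᵢ}) = 1 - e_{sᵢ}` and `sᵢ(e_s) = e_{sᵢ s sᵢ}` for `s ≠ sᵢ`; it satisfies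
`w(e_s) = e_{w s w⁻¹}` if `ℓ(ws) > ℓ(w)` and `w(e_s) = 1 - e_{w s w⁻¹}` if `ℓ(ws) < ℓ(w)`;
(b) for every `s ∈ 𝒮` there is an additive map `d_s : D̂ → D̂` with
`d_s(x·y) = d_s(x)·y + s(x)·d_s(y)` and `d_s(e_{s'}) = δ_{s,s'}`. -/
theorem action_and_derivations_on_D {B : Type*} (M : CoxeterMatrix B) :
    (∃! ρ : M.Group →* (FD M ≃ₐ[ℤ] FD M), SimpleActionCond M ρ) ∧
    (∀ ρ : M.Group →* (FD M ≃ₐ[ℤ] FD M), SimpleActionCond M ρ →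
      ((∀ (w : M.Group) (t : Refl M)
          (h : M.toCoxeterSystem.IsReflection (w * (t : M.Group) * w⁻¹)),
        (M.toCoxeterSystem.length (w * (t : M.Group)) > M.toCoxeterSystem.length w →
          ρ w (eg M t) = eg M ⟨w * (t : M.Group) * w⁻¹, h⟩) ∧
        (M.toCoxeterSystem.length (w * (t : M.Group)) < M.toCoxeterSystem.length w →
          ρ w (eg M t) = 1 - eg M ⟨w * (t : M.Group) * w⁻¹, h⟩)) ∧
      (∀ t : Refl M, ∃ d : FD M →+ FD M,
        (∀ x y : FD M, d (x * y) = d x * y + ρ (t : M.Group) x * d y) ∧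
        (∀ t' : Refl M, t = t' → d (eg M t') = 1) ∧
        (∀ t' : Refl M, t ≠ t' → d (eg M t') = 0)))) := by
  refine ⟨⟨action M, (simpleActionCond_iff M _).2 fun i t => action_eg M _ t, fun ρ hρ => ?_⟩,
    fun ρ hρ => ⟨fun w t h => ⟨fun hw => ?_, fun hw => ?_⟩, fun t => ?_⟩⟩
  · refine MonoidHom.ext fun w => AlgEquiv.coe_toAlgHom_injective <| algHom_ext_eg fun t => ?_
    refine (hρ.apply_eg w t).trans ?_
    rw [AlgEquiv.coe_toAlgHom, action_eg, signedAction_apply, zero_add]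
  · rw [hρ.apply_eg, inversionParity_eq_zero_of_lt M hw, signedIdem_zero]
    rfl
  · rw [hρ.apply_eg, inversionParity_eq_one_of_lt M hw, signedIdem_one]
    rfl
  · classical
    obtain ⟨d, hd, hd_eg⟩ := exists_twistedDerivation M (ρ t : FD M →ₐ[ℤ] FD M)
      (fun t' => if t = t' then 1 else 0) fun t' => by
        split_ifs with h
        · subst h
          simp [hρ.apply_eg_self]
        · simp
    exact ⟨d, hd, fun t' h => (hd_eg t').trans (if_pos h),
      fun t' h => (hd_eg t').trans (if_neg h)⟩

end HeckeHopfCox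
end

section
/- Let R be a commutative ring, H a Hopf algebra over R that is free as an R-module, A ⊆ H a Hopf subalgebra, and D ⊆ H a left coideal subalgebra (a subalgebra with Δ(D) contained in the image of H ⊗ D in H ⊗ H). Define the adjoint action of A on H by ad_h(x) = h₍₁₎ · x · S(h₍₂₎) (i.e., the image of h ⊗ x under m ∘ (m ⊗ S) ∘ (id_H ⊗ τ_{H,H}) ∘ (Δ ⊗ id_H), where m is multiplication, τ the flip, and S the antipode), and set K(A,D) = { x ∈ D : ad_h(x) ∈ D for all h ∈ A }. Then the two-sided ideal J of H generated by K(A,D) ∩ ker ε is a Hopf ideal: Δ(J) ⊆ H ⊗ J + J ⊗ H, ε(J) = 0, and S(J) ⊆ J; consequently the quotient H/J inherits a Hopf algebra structure over R. -/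
open scoped TensorProduct

namespace GeneralHopf

section

variable (R : Type*) (H : Type*) [CommRing R] [Ring H] [HopfAlgebra R H]

/-- The adjoint action `h ⊗ x ↦ h₍₁₎ · x · S(h₍₂₎)` of a Hopf algebra on itself, as the
linear map `m ∘ (m ⊗ S) ∘ (id ⊗ τ) ∘ (Δ ⊗ id) : H ⊗ H → H` (written here with explicit
associators). -/
noncomputable def adMap : H ⊗[R] H →ₗ[R] H :=
  (LinearMap.mul' R H) ∘ₗ
    (LinearMap.lTensor H (LinearMap.mul' R H)) ∘ₗ
    (LinearMap.lTensor H (LinearMap.lTensor H (HopfAlgebra.antipode (R := R)))) ∘ₗ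
    (LinearMap.lTensor H (TensorProduct.comm R H H).toLinearMap) ∘ₗ
    (TensorProduct.assoc R H H H).toLinearMap ∘ₗ
    (LinearMap.rTensor H (Coalgebra.comul (R := R)))

/-- `K(A, D) = {x ∈ D : ad_h(x) ∈ D for all h ∈ A}`. -/
def Kset (A D : Subalgebra R H) : Set H :=
  {x | x ∈ D ∧ ∀ h ∈ A, adMap R H (h ⊗ₜ[R] x) ∈ D}

/-- The two-sided ideal `J` of `H` generated by `K(A,D) ∩ ker ε`, as an `R`-submodule. -/
noncomputable def Jideal (A D : Subalgebra R H) : Submodule R H :=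
  Submodule.span R
    {y | ∃ a k b : H, k ∈ Kset R H A D ∧ Coalgebra.counit (R := R) k = (0 : R) ∧ y = a * k * b}

/-- The relation presenting the quotient `H/J`. -/
def quotRel (A D : Subalgebra R H) : H → H → Prop :=
  fun x y => x ∈ Kset R H A D ∧ Coalgebra.counit (R := R) x = (0 : R) ∧ y = 0

end

/-- A Hopf algebra structure on an `R`-algebra `A`: an algebra-homomorphism
comultiplication and counit and an anti-homomorphism antipode, satisfying the
coassociativity, counit and antipode axioms. -/
structure HopfAlgStruct (R : Type*) (A : Type*) [CommRing R] [Ring A] [Algebra R A] where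
  comul : A →ₐ[R] A ⊗[R] A
  counit : A →ₐ[R] R
  antipode : A →ₗ[R] A
  antipode_one : antipode 1 = 1
  antipode_mul : ∀ x y : A, antipode (x * y) = antipode y * antipode x
  coassoc : ∀ x : A,
    (TensorProduct.assoc R A A A) ((Algebra.TensorProduct.map comul (AlgHom.id R A)) (comul x)) =
      (Algebra.TensorProduct.map (AlgHom.id R A) comul) (comul x)
  counit_comul : ∀ x : A,
    (TensorProduct.lid R A) ((LinearMap.rTensor A counit.toLinearMap) (comul x)) = x
  comul_counit : ∀ x : A,
    (TensorProduct.rid R A) ((LinearMap.lTensor A counit.toLinearMap) (comul x)) = x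
  mul_antipode_rTensor_comul : ∀ x : A,
    (LinearMap.mul' R A) ((LinearMap.rTensor A antipode) (comul x)) = algebraMap R A (counit x)
  mul_antipode_lTensor_comul : ∀ x : A,
    (LinearMap.mul' R A) ((LinearMap.lTensor A antipode) (comul x)) = algebraMap R A (counit x)

open Coalgebra HopfAlgebra WithConv

section Slices

variable {R M N : Type*} [CommRing R] [AddCommGroup M] [Module R M] [AddCommGroup N] [Module R N]

/-- The slice map `φ ⊗ id : M ⊗ N → R ⊗ N ≅ N` of a functional `φ` on `M`. -/
noncomputable def slice (φ : M →ₗ[R] R) : M ⊗[R] N →ₗ[R] N :=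
  (TensorProduct.lid R N).toLinearMap ∘ₗ LinearMap.rTensor N φ

@[simp]
lemma slice_tmul (φ : M →ₗ[R] R) (m : M) (n : N) : slice φ (m ⊗ₜ[R] n) = φ m • n := by
  simp [slice]

lemma slice_lTensor (φ : M →ₗ[R] R) (f : N →ₗ[R] N) (t : M ⊗[R] N) :
    slice φ (LinearMap.lTensor M f t) = f (slice φ t) := by
  induction t with
  | zero => simp
  | tmul m n => simp
  | add s t hs ht => simp only [map_add, hs, ht]

lemma tmul_mem_range_lTensor {P : Submodule R N} (m : M) {n : N} (hn : n ∈ P) :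
    m ⊗ₜ[R] n ∈ LinearMap.range (LinearMap.lTensor M P.subtype) :=
  ⟨m ⊗ₜ ⟨n, hn⟩, by simp⟩

lemma tmul_mem_range_rTensor {P : Submodule R M} {m : M} (hm : m ∈ P) (n : N) :
    m ⊗ₜ[R] n ∈ LinearMap.range (LinearMap.rTensor N P.subtype) :=
  ⟨⟨m, hm⟩ ⊗ₜ n, by simp⟩

/-- Over a free module `M`, membership in the image of `M ⊗ P` is detected by slices. -/
lemma mem_range_lTensor_iff_slice [Module.Free R M] {P : Submodule R N} {t : M ⊗[R] N} :
    t ∈ LinearMap.range (LinearMap.lTensor M P.subtype) ↔ ∀ φ : M →ₗ[R] R, slice φ t ∈ P := by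
  constructor
  · rintro ⟨s, rfl⟩ φ
    induction s with
    | zero => simp
    | tmul m n => simpa using P.smul_mem _ n.2
    | add s t hs ht => simpa only [map_add] using P.add_mem hs ht
  · intro h
    let b := Module.Free.chooseBasis R M
    have ht := (TensorProduct.equivFinsuppOfBasisLeft (N := N) b).symm_apply_apply t
    rw [TensorProduct.equivFinsuppOfBasisLeft_symm_apply] at ht
    rw [← ht]
    refine Submodule.sum_mem _ fun i _ ↦ tmul_mem_range_lTensor _ ?_
    rw [TensorProduct.equivFinsuppOfBasisLeft_apply]
    exact h (b.coord i)

end Slices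

section Convolution

variable {R C B : Type*} [CommRing R] [AddCommGroup C] [Module R C] [Coalgebra R C]
  [Ring B] [Algebra R B]

/-- The convolution element `h ↦ ε(h) x`. -/
noncomputable def convConst (C : Type*) [AddCommGroup C] [Module R C] [Coalgebra R C] (x : B) :
    WithConv (C →ₗ[R] B) :=
  toConv (LinearMap.toSpanSingleton R B x ∘ₗ counit)

lemma convConst_mul (x : B) (f : WithConv (C →ₗ[R] B)) :
    convConst C x * f = toConv (LinearMap.mulLeft R x ∘ₗ f.ofConv) := by
  ext h
  have : TensorProduct.map (LinearMap.toSpanSingleton R B x ∘ₗ counit) f.ofConv (comul (R := R) h) =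
      TensorProduct.map (LinearMap.toSpanSingleton R B x) f.ofConv
        (LinearMap.rTensor C counit (comul h)) := by
    rw [← LinearMap.map_comp_rTensor, LinearMap.comp_apply]
  simp [convConst, this]

lemma convMul_apply_mem {P : Submodule R B} {Q : Submodule R C} {h : C}
    (hh : comul (R := R) h ∈ LinearMap.range (TensorProduct.map Q.subtype Q.subtype))
    (f g : WithConv (C →ₗ[R] B)) (hfg : ∀ a ∈ Q, ∀ b ∈ Q, f a * g b ∈ P) : (f * g) h ∈ P := by
  obtain ⟨t, ht⟩ := hh
  rw [LinearMap.convMul_apply, ← ht]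
  clear ht
  induction t with
  | zero => simp
  | tmul a b => simpa using hfg a a.2 b b.2
  | add s t hs ht => simpa only [map_add] using P.add_mem hs ht

lemma comp_convConst {B' : Type*} [Ring B'] [Algebra R B'] (F : B →ₐ[R] B') (x : B) :
    toConv (F.toLinearMap ∘ₗ (convConst C x : WithConv (C →ₗ[R] B)).ofConv) =
      convConst C (F x) := by
  ext h
  simp [convConst]

lemma comp_convMul {B' : Type*} [Ring B'] [Algebra R B'] (F : B →ₐ[R] B')
    (f g : WithConv (C →ₗ[R] B)) :
    toConv (F.toLinearMap ∘ₗ (f * g).ofConv) =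
      toConv (F.toLinearMap ∘ₗ f.ofConv) * toConv (F.toLinearMap ∘ₗ g.ofConv) := by
  rw [LinearMap.algHom_comp_convMul_distrib]

end Convolution

section Adjoint

variable {R H : Type*} [CommRing R] [Ring H] [HopfAlgebra R H]

variable (R) in
/-- The map `h ↦ ad_h(x)` as a convolution product. -/
noncomputable def convAd (x : H) : WithConv (H →ₗ[R] H) :=
  toConv LinearMap.id * (convConst H x * toConv (antipode R))

lemma adMap_tmul (h x : H) : adMap R H (h ⊗ₜ x) = convAd R x h := by
  rw [convAd, convConst_mul, LinearMap.convMul_apply]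
  simp only [adMap, LinearMap.comp_apply, LinearMap.rTensor_tmul]
  induction comul (R := R) h with
  | zero => simp
  | tmul a b => simp
  | add s t hs ht => simp only [map_add, TensorProduct.add_tmul, hs, ht]

lemma adMap_tmul_one (h : H) : adMap R H (h ⊗ₜ 1) = algebraMap R H (counit h) := by
  have : (convConst H 1 : WithConv (H →ₗ[R] H)) = 1 := by
    ext h
    simp [convConst, Algebra.algebraMap_eq_smul_one]
  rw [adMap_tmul, convAd, this, one_mul, LinearMap.id_mul_antipode, LinearMap.convOne_apply]

/-- Composing the antipode relation with an algebra homomorphism. -/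
lemma comp_antipode_mul {B : Type*} [Ring B] [Algebra R B] (F : H →ₐ[R] B) :
    toConv (F.toLinearMap ∘ₗ antipode R) * toConv F.toLinearMap = 1 := by
  have := comp_convMul F (toConv (antipode R)) (toConv (LinearMap.id : H →ₗ[R] H))
  rw [LinearMap.antipode_mul_id] at this
  simp only [LinearMap.comp_id] at this
  rw [← this]
  ext h
  simp

lemma mul_comp_antipode {B : Type*} [Ring B] [Algebra R B] (F : H →ₐ[R] B) :
    toConv F.toLinearMap * toConv (F.toLinearMap ∘ₗ antipode R) = 1 := by
  have := comp_convMul F (toConv (LinearMap.id : H →ₗ[R] H)) (toConv (antipode R))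
  rw [LinearMap.id_mul_antipode] at this
  simp only [LinearMap.comp_id] at this
  rw [← this]
  ext h
  simp

lemma comp_convAd {B : Type*} [Ring B] [Algebra R B] (F : H →ₐ[R] B) (x : H) :
    toConv (F.toLinearMap ∘ₗ (convAd R x).ofConv) =
      toConv F.toLinearMap * (convConst H (F x) * toConv (F.toLinearMap ∘ₗ antipode R)) := by
  rw [convAd, comp_convMul, comp_convMul, comp_convConst]
  rfl

variable (R H) in
/-- The first-leg embedding `h ↦ h ⊗ 1`. -/
noncomputable abbrev legLeft : H →ₐ[R] H ⊗[R] H := Algebra.TensorProduct.includeLeft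

variable (R H) in
/-- The second-leg embedding `h ↦ 1 ⊗ h`. -/
noncomputable abbrev legRight : H →ₐ[R] H ⊗[R] H := Algebra.TensorProduct.includeRight

lemma comul_eq_convMul :
    toConv (Bialgebra.comulAlgHom R H).toLinearMap =
      toConv (legLeft R H).toLinearMap * toConv (legRight R H).toLinearMap := by
  ext h
  rw [LinearMap.convMul_apply]
  change comul h = _
  induction comul (R := R) h with
  | zero => simp
  | tmul a b => simp
  | add s t hs ht => rw [map_add, map_add, ← hs, ← ht]

lemma comul_antipode_eq_convMul :
    toConv ((Bialgebra.comulAlgHom R H).toLinearMap ∘ₗ antipode R) =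
      toConv ((legRight R H).toLinearMap ∘ₗ antipode R) *
        toConv ((legLeft R H).toLinearMap ∘ₗ antipode R) := by
  symm
  refine left_inv_eq_right_inv (a := toConv (Bialgebra.comulAlgHom R H).toLinearMap) ?_
    (mul_comp_antipode _)
  rw [comul_eq_convMul, mul_assoc, ← mul_assoc (toConv ((legLeft R H).toLinearMap ∘ₗ _)),
    comp_antipode_mul, one_mul, comp_antipode_mul]

/-- The identity `x₍₁₎ ⊗ ad_h(x₍₂₎) = (S(h₍₁₎) ⊗ 1) Δ(ad_{h₍₂₎}(x)) (h₍₃₎ ⊗ 1)`. -/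
lemma lTensor_ad_comul (h x : H) :
    LinearMap.lTensor H (adMap R H ∘ₗ TensorProduct.mk R H H h) (comul x) =
      (toConv ((legLeft R H).toLinearMap ∘ₗ antipode R) *
        (toConv ((Bialgebra.comulAlgHom R H).toLinearMap ∘ₗ (convAd R x).ofConv) *
          toConv (legLeft R H).toLinearMap)) h := by
  have key : toConv ((legLeft R H).toLinearMap ∘ₗ antipode R) *
        (toConv ((Bialgebra.comulAlgHom R H).toLinearMap ∘ₗ (convAd R x).ofConv) *
          toConv (legLeft R H).toLinearMap) =
      toConv (legRight R H).toLinearMap * (convConst H (comul x) *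
        toConv ((legRight R H).toLinearMap ∘ₗ antipode R)) := by
    rw [comp_convAd, comul_antipode_eq_convMul, comul_eq_convMul]
    simp only [mul_assoc, comp_antipode_mul, mul_one]
    rw [← mul_assoc, comp_antipode_mul, one_mul]
    rfl
  rw [key, convConst_mul]
  induction comul (R := R) x with
  | zero => simp
  | tmul a b =>
    rw [LinearMap.lTensor_tmul, LinearMap.comp_apply, TensorProduct.mk_apply, adMap_tmul, convAd,
      convConst_mul, LinearMap.convMul_apply, LinearMap.convMul_apply]
    induction comul (R := R) h with
    | zero => simp
    | tmul c d => simp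
    | add s t hs ht => simp only [map_add, TensorProduct.tmul_add, hs, ht]
  | add s t hs ht =>
    rw [map_add, hs, ht]
    simp only [LinearMap.convMul_apply]
    induction comul (R := R) h with
    | zero => simp
    | tmul c d => simp [mul_add, add_mul]
    | add u v hu hv => simp only [map_add, ← hu, ← hv]; abel

end Adjoint

section Invariants

variable {R H : Type*} [CommRing R] [Ring H] [HopfAlgebra R H]

variable (R H) in
/-- `K(A, D)` as a submodule. -/
noncomputable def Ksubmodule (A D : Subalgebra R H) : Submodule R H where
  carrier := Kset R H A D
  zero_mem' := ⟨D.zero_mem, fun h _ ↦ by simp⟩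
  add_mem' hx hy := ⟨D.add_mem hx.1 hy.1, fun h hh ↦ by
    rw [TensorProduct.tmul_add, map_add]; exact D.add_mem (hx.2 h hh) (hy.2 h hh)⟩
  smul_mem' r x hx := ⟨D.smul_mem hx.1 r, fun h hh ↦ by
    rw [TensorProduct.tmul_smul, map_smul]; exact D.smul_mem (hx.2 h hh) r⟩

lemma one_mem_Ksubmodule (A D : Subalgebra R H) : 1 ∈ Ksubmodule R H A D :=
  ⟨D.one_mem, fun h _ ↦ by rw [adMap_tmul_one]; exact D.algebraMap_mem _⟩

lemma range_lTensor_tmul_one_mul {P : Submodule R H} {t : H ⊗[R] H} (a b : H)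
    (ht : t ∈ LinearMap.range (LinearMap.lTensor H P.subtype)) :
    (a ⊗ₜ[R] (1 : H)) * (t * (b ⊗ₜ[R] (1 : H))) ∈
      LinearMap.range (LinearMap.lTensor H P.subtype) := by
  obtain ⟨s, rfl⟩ := ht
  induction s with
  | zero => simp
  | tmul m n => simpa using tmul_mem_range_lTensor (a * (m * b)) n.2
  | add s t hs ht => simpa only [map_add, add_mul, mul_add] using Submodule.add_mem _ hs ht

/-- `K(A, D)` is a left coideal. -/
lemma comul_mem_of_mem_Ksubmodule [Module.Free R H] {A D : Subalgebra R H}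
    (hA : ∀ a ∈ A, comul (R := R) a ∈
      LinearMap.range (TensorProduct.map (Subalgebra.toSubmodule A).subtype
        (Subalgebra.toSubmodule A).subtype))
    (hD : ∀ d ∈ D, comul (R := R) d ∈
      LinearMap.range (LinearMap.lTensor H (Subalgebra.toSubmodule D).subtype))
    {x : H} (hx : x ∈ Ksubmodule R H A D) :
    comul (R := R) x ∈ LinearMap.range (LinearMap.lTensor H (Ksubmodule R H A D).subtype) := by
  rw [mem_range_lTensor_iff_slice]
  intro φ
  refine ⟨mem_range_lTensor_iff_slice.1 (hD x hx.1) φ, fun h hh ↦ ?_⟩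
  have hs := slice_lTensor φ (adMap R H ∘ₗ TensorProduct.mk R H H h) (comul (R := R) x)
  rw [LinearMap.comp_apply, TensorProduct.mk_apply] at hs
  rw [← hs]
  refine (mem_range_lTensor_iff_slice (P := Subalgebra.toSubmodule D)).1 ?_ φ
  rw [lTensor_ad_comul]
  refine convMul_apply_mem (hA h hh) _ _ fun a _ b hb ↦ ?_
  refine convMul_apply_mem (P := (LinearMap.range (LinearMap.lTensor H
    (Subalgebra.toSubmodule D).subtype)).comap (LinearMap.mulLeft R _)) (hA b hb) _ _
    fun c hc d _ ↦ range_lTensor_tmul_one_mul (antipode R a) d (hD _ ?_)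
  have := hx.2 c hc
  rwa [adMap_tmul] at this

end Invariants

section HopfIdeal

variable {R H : Type*} [CommRing R] [Ring H] [HopfAlgebra R H] {A D : Subalgebra R H}

lemma mem_Jideal {k : H} (hk : k ∈ Kset R H A D) (hε : counit (R := R) k = (0 : R)) :
    k ∈ Jideal R H A D :=
  Submodule.subset_span ⟨1, k, 1, hk, hε, by simp⟩

lemma mul_mem_Jideal (a b : H) {x : H} (hx : x ∈ Jideal R H A D) :
    a * x * b ∈ Jideal R H A D := by
  induction hx using Submodule.span_induction with
  | mem x hx =>
    obtain ⟨c, k, d, hk, hε, rfl⟩ := hx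
    exact Submodule.subset_span ⟨a * c, k, d * b, hk, hε, by simp only [mul_assoc]⟩
  | zero => simp
  | add x y _ _ hx hy => simpa only [mul_add, add_mul] using Submodule.add_mem _ hx hy
  | smul r x _ hx => simpa using Submodule.smul_mem _ r hx

/-- The submodule `H ⊗ P + P ⊗ H` of `H ⊗ H`. -/
noncomputable abbrev twoSided (P : Submodule R H) : Submodule R (H ⊗[R] H) :=
  LinearMap.range (LinearMap.lTensor H P.subtype) ⊔ LinearMap.range (LinearMap.rTensor H P.subtype)

lemma mul_mem_twoSided {P : Submodule R H} (hP : ∀ a b : H, ∀ x ∈ P, a * x * b ∈ P)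
    (u v : H ⊗[R] H) {t : H ⊗[R] H} (ht : t ∈ twoSided P) : u * t * v ∈ twoSided P := by
  induction u with
  | zero => simp
  | add u u' hu hu' => simpa only [add_mul] using Submodule.add_mem _ hu hu'
  | tmul a b =>
    induction v with
    | zero => simp
    | add v v' hv hv' => simpa only [mul_add] using Submodule.add_mem _ hv hv'
    | tmul c d =>
      obtain ⟨_, ⟨s, rfl⟩, _, ⟨s', rfl⟩, rfl⟩ := Submodule.mem_sup.1 ht
      rw [mul_add, add_mul]
      clear ht
      refine Submodule.add_mem_sup ?_ ?_
      · induction s with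
        | zero => simp
        | tmul m n => simpa using tmul_mem_range_lTensor (a * m * c) (hP b d n n.2)
        | add s t hs ht => simpa only [map_add, mul_add, add_mul] using Submodule.add_mem _ hs ht
      · induction s' with
        | zero => simp
        | tmul m n => simpa using tmul_mem_range_rTensor (hP a c m m.2) (b * n * d)
        | add s t hs ht => simpa only [map_add, mul_add, add_mul] using Submodule.add_mem _ hs ht

/-- The decomposition `t - (id ⊗ ε)(t) ⊗ 1` of an element of `H ⊗ K`. -/
lemma sub_counit_tmul_one_mem {t : H ⊗[R] H}
    (ht : t ∈ LinearMap.range (LinearMap.lTensor H (Ksubmodule R H A D).subtype)) :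
    t - (TensorProduct.rid R H (LinearMap.lTensor H counit t)) ⊗ₜ[R] (1 : H) ∈
      LinearMap.range (LinearMap.lTensor H (Jideal R H A D).subtype) := by
  obtain ⟨s, rfl⟩ := ht
  induction s with
  | zero => simp
  | tmul m k =>
    have hk : (k : H) - counit (R := R) (k : H) • (1 : H) ∈ Jideal R H A D :=
      mem_Jideal ((Ksubmodule R H A D).sub_mem k.2
        ((Ksubmodule R H A D).smul_mem _ (one_mem_Ksubmodule A D))) (by simp)
    simpa [TensorProduct.tmul_sub, TensorProduct.smul_tmul] using tmul_mem_range_lTensor m hk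
  | add s t hs ht =>
    simp only [map_add, TensorProduct.add_tmul, add_sub_add_comm]
    exact Submodule.add_mem _ hs ht

lemma comul_sub_tmul_one_mem {k : H}
    (hk : comul (R := R) k ∈ LinearMap.range (LinearMap.lTensor H (Ksubmodule R H A D).subtype)) :
    comul (R := R) k - k ⊗ₜ[R] (1 : H) ∈
      LinearMap.range (LinearMap.lTensor H (Jideal R H A D).subtype) := by
  simpa using sub_counit_tmul_one_mem hk

lemma comul_mem_twoSided_Jideal
    (hK : ∀ k ∈ Kset R H A D,
      comul (R := R) k ∈ LinearMap.range (LinearMap.lTensor H (Ksubmodule R H A D).subtype))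
    {x : H} (hx : x ∈ Jideal R H A D) : comul (R := R) x ∈ twoSided (Jideal R H A D) := by
  induction hx using Submodule.span_induction with
  | mem x hx =>
    obtain ⟨c, k, d, hk, hε, rfl⟩ := hx
    rw [Bialgebra.comul_mul, Bialgebra.comul_mul]
    refine mul_mem_twoSided (fun a b x hx ↦ mul_mem_Jideal a b hx) _ _ ?_
    rw [← sub_add_cancel (comul (R := R) k) (k ⊗ₜ[R] (1 : H))]
    exact Submodule.add_mem_sup (comul_sub_tmul_one_mem (hK k hk))
      (tmul_mem_range_rTensor (mem_Jideal hk hε) 1)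
  | zero => simp
  | add x y _ _ hx hy => simpa only [map_add] using Submodule.add_mem _ hx hy
  | smul r x _ hx => simpa only [map_smul] using Submodule.smul_mem _ r hx

lemma counit_eq_zero_of_mem_Jideal {x : H} (hx : x ∈ Jideal R H A D) :
    counit (R := R) x = (0 : R) := by
  induction hx using Submodule.span_induction with
  | mem x hx =>
    obtain ⟨c, k, d, hk, hε, rfl⟩ := hx
    simp [hε]
  | zero => simp
  | add x y _ _ hx hy => simp [hx, hy]
  | smul r x _ hx => simp [hx]

lemma antipode_mem_Jideal
    (hK : ∀ k ∈ Kset R H A D,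
      comul (R := R) k ∈ LinearMap.range (LinearMap.lTensor H (Ksubmodule R H A D).subtype))
    {x : H} (hx : x ∈ Jideal R H A D) : antipode R x ∈ Jideal R H A D := by
  induction hx using Submodule.span_induction with
  | mem x hx =>
    obtain ⟨c, k, d, hk, hε, rfl⟩ := hx
    rw [antipode_mul_antidistrib, antipode_mul_antidistrib, ← mul_assoc]
    refine mul_mem_Jideal _ _ ?_
    have hmul : ∀ t ∈ LinearMap.range (LinearMap.lTensor H (Jideal R H A D).subtype),
        LinearMap.mul' R H (LinearMap.rTensor H (antipode R) t) ∈ Jideal R H A D := by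
      rintro _ ⟨s, rfl⟩
      induction s with
      | zero => simp
      | tmul m n => simpa using mul_mem_Jideal (antipode R m) 1 n.2
      | add s t hs ht => simpa only [map_add] using Submodule.add_mem _ hs ht
    have := hmul _ (comul_sub_tmul_one_mem (hK k hk))
    rw [map_sub, map_sub, mul_antipode_rTensor_comul_apply, hε] at this
    simpa using this
  | zero => simp
  | add x y _ _ hx hy => simpa only [map_add] using Submodule.add_mem _ hx hy
  | smul r x _ hx => simpa only [map_smul] using Submodule.smul_mem _ r hx

end HopfIdeal

section Quotient

variable {R H : Type*} [CommRing R] [Ring H] [HopfAlgebra R H]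

/-- A surjective algebra homomorphism along which comultiplication, counit and antipode
descend transports the Hopf algebra structure. -/
noncomputable def hopfAlgStructOfSurjective {Q : Type*} [Ring Q] [Algebra R Q] (p : H →ₐ[R] Q)
    (hp : Function.Surjective p) (Δ : Q →ₐ[R] Q ⊗[R] Q) (ε : Q →ₐ[R] R) (S : Q →ₗ[R] Q)
    (hΔ : ∀ x, Δ (p x) = TensorProduct.map p.toLinearMap p.toLinearMap (comul x))
    (hε : ∀ x, ε (p x) = counit x) (hS : ∀ x, S (p x) = p (antipode R x)) :
    HopfAlgStruct R Q where
  comul := Δ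
  counit := ε
  antipode := S
  antipode_one := by rw [← map_one p, hS, antipode_one]
  antipode_mul := by
    intro x y
    obtain ⟨x, rfl⟩ := hp x
    obtain ⟨y, rfl⟩ := hp y
    rw [← map_mul, hS, hS, hS, antipode_mul_antidistrib, map_mul]
  coassoc := by
    intro x
    obtain ⟨x, rfl⟩ := hp x
    have hl : ∀ t : H ⊗[R] H, TensorProduct.assoc R Q Q Q
        (Algebra.TensorProduct.map Δ (AlgHom.id R Q)
          (TensorProduct.map p.toLinearMap p.toLinearMap t)) =
        TensorProduct.map p.toLinearMap (TensorProduct.map p.toLinearMap p.toLinearMap)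
          (TensorProduct.assoc R H H H (LinearMap.rTensor H comul t)) := by
      intro t
      induction t with
      | zero => simp
      | tmul a b =>
        simp only [TensorProduct.map_tmul, AlgHom.toLinearMap_apply,
          Algebra.TensorProduct.map_tmul, hΔ, LinearMap.rTensor_tmul, AlgHom.id_apply]
        induction comul (R := R) a with
        | zero => simp
        | tmul c d => simp
        | add s t hs ht => simp only [map_add, TensorProduct.add_tmul, hs, ht]
      | add s t hs ht => simp only [map_add, hs, ht]
    have hr : ∀ t : H ⊗[R] H, Algebra.TensorProduct.map (AlgHom.id R Q) Δ
          (TensorProduct.map p.toLinearMap p.toLinearMap t) =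
        TensorProduct.map p.toLinearMap (TensorProduct.map p.toLinearMap p.toLinearMap)
          (LinearMap.lTensor H comul t) := by
      intro t
      induction t with
      | zero => simp
      | tmul a b => simp [hΔ]
      | add s t hs ht => simp only [map_add, hs, ht]
    rw [hΔ, hl, hr, Coalgebra.coassoc_apply]
  counit_comul := by
    intro x
    obtain ⟨x, rfl⟩ := hp x
    have h : ∀ t : H ⊗[R] H, TensorProduct.lid R Q (LinearMap.rTensor Q ε.toLinearMap
        (TensorProduct.map p.toLinearMap p.toLinearMap t)) =
        p (TensorProduct.lid R H (LinearMap.rTensor H counit t)) := by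
      intro t
      induction t with
      | zero => simp
      | tmul a b => simp [hε]
      | add s t hs ht => simp only [map_add, hs, ht]
    rw [hΔ, h]
    simp
  comul_counit := by
    intro x
    obtain ⟨x, rfl⟩ := hp x
    have h : ∀ t : H ⊗[R] H, TensorProduct.rid R Q (LinearMap.lTensor Q ε.toLinearMap
        (TensorProduct.map p.toLinearMap p.toLinearMap t)) =
        p (TensorProduct.rid R H (LinearMap.lTensor H counit t)) := by
      intro t
      induction t with
      | zero => simp
      | tmul a b => simp [hε]
      | add s t hs ht => simp only [map_add, hs, ht]
    rw [hΔ, h]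
    simp
  mul_antipode_rTensor_comul := by
    intro x
    obtain ⟨x, rfl⟩ := hp x
    have h : ∀ t : H ⊗[R] H, LinearMap.mul' R Q (LinearMap.rTensor Q S
        (TensorProduct.map p.toLinearMap p.toLinearMap t)) =
        p (LinearMap.mul' R H (LinearMap.rTensor H (antipode R) t)) := by
      intro t
      induction t with
      | zero => simp
      | tmul a b => simp [hS]
      | add s t hs ht => simp only [map_add, hs, ht]
    rw [hΔ, h, mul_antipode_rTensor_comul_apply, AlgHom.commutes, hε]
  mul_antipode_lTensor_comul := by
    intro x
    obtain ⟨x, rfl⟩ := hp x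
    have h : ∀ t : H ⊗[R] H, LinearMap.mul' R Q (LinearMap.lTensor Q S
        (TensorProduct.map p.toLinearMap p.toLinearMap t)) =
        p (LinearMap.mul' R H (LinearMap.lTensor H (antipode R) t)) := by
      intro t
      induction t with
      | zero => simp
      | tmul a b => simp [hS]
      | add s t hs ht => simp only [map_add, hs, ht]
    rw [hΔ, h, mul_antipode_lTensor_comul_apply, AlgHom.commutes, hε]

variable {A D : Subalgebra R H}

lemma mkAlgHom_eq_zero_of_mem_Jideal {x : H} (hx : x ∈ Jideal R H A D) :
    RingQuot.mkAlgHom R (quotRel R H A D) x = 0 := by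
  induction hx using Submodule.span_induction with
  | mem x hx =>
    obtain ⟨c, k, d, hk, hε, rfl⟩ := hx
    rw [map_mul, map_mul, RingQuot.mkAlgHom_rel R (s := quotRel R H A D) ⟨hk, hε, rfl⟩]
    simp
  | zero => simp
  | add x y _ _ hx hy => simp [hx, hy]
  | smul r x _ hx => simp [hx]

lemma map_eq_zero_of_mem_twoSided {Q : Type*} [Ring Q] [Algebra R Q] (p : H →ₐ[R] Q)
    {P : Submodule R H} (hP : ∀ x ∈ P, p x = 0) {t : H ⊗[R] H} (ht : t ∈ twoSided P) :
    Algebra.TensorProduct.map p p t = 0 := by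
  obtain ⟨_, ⟨s, rfl⟩, _, ⟨s', rfl⟩, rfl⟩ := Submodule.mem_sup.1 ht
  clear ht
  have h₁ : Algebra.TensorProduct.map p p (LinearMap.lTensor H P.subtype s) = 0 := by
    induction s with
    | zero => simp
    | tmul m n => simp [hP n n.2]
    | add s t hs ht => simp only [map_add, hs, ht, add_zero]
  have h₂ : Algebra.TensorProduct.map p p (LinearMap.rTensor H P.subtype s') = 0 := by
    induction s' with
    | zero => simp
    | tmul m n => simp [hP m m.2]
    | add s t hs ht => simp only [map_add, hs, ht, add_zero]
  rw [map_add, h₁, h₂, add_zero]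

lemma exists_hopfAlgStruct_ringQuot
    (hΔ : ∀ x ∈ Jideal R H A D, comul (R := R) x ∈ twoSided (Jideal R H A D))
    (hS : ∀ x ∈ Jideal R H A D, antipode R x ∈ Jideal R H A D) :
    ∃ Hq : HopfAlgStruct R (RingQuot (quotRel R H A D)),
      (∀ x : H, Hq.comul (RingQuot.mkAlgHom R (quotRel R H A D) x) =
          (TensorProduct.map (RingQuot.mkAlgHom R (quotRel R H A D)).toLinearMap
            (RingQuot.mkAlgHom R (quotRel R H A D)).toLinearMap) (comul (R := R) x)) ∧
      (∀ x : H, Hq.counit (RingQuot.mkAlgHom R (quotRel R H A D) x) = counit (R := R) x) ∧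
      (∀ x : H, Hq.antipode (RingQuot.mkAlgHom R (quotRel R H A D) x) =
          RingQuot.mkAlgHom R (quotRel R H A D) (antipode (R := R) x)) := by
  let p := RingQuot.mkAlgHom R (quotRel R H A D)
  let Δ : RingQuot (quotRel R H A D) →ₐ[R] _ := RingQuot.liftAlgHom R
    ⟨(Algebra.TensorProduct.map p p).comp (Bialgebra.comulAlgHom R H), by
      rintro x y ⟨hx, hε, rfl⟩
      rw [map_zero]
      exact map_eq_zero_of_mem_twoSided p (fun _ ↦ mkAlgHom_eq_zero_of_mem_Jideal)
        (hΔ x (mem_Jideal hx hε))⟩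
  let ε : RingQuot (quotRel R H A D) →ₐ[R] R := RingQuot.liftAlgHom R
    ⟨Bialgebra.counitAlgHom R H, by
      rintro x y ⟨hx, hε, rfl⟩
      simpa using hε⟩
  let S : RingQuot (quotRel R H A D) →ₐ[R] (RingQuot (quotRel R H A D))ᵐᵒᵖ := RingQuot.liftAlgHom R
    ⟨(AlgHom.op p).comp (antipodeAlgHomOp R H), by
      rintro x y ⟨hx, hε, rfl⟩
      rw [map_zero]
      exact congrArg MulOpposite.op
        (mkAlgHom_eq_zero_of_mem_Jideal (hS x (mem_Jideal hx hε)))⟩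
  have hΔ' : ∀ x, Δ (p x) = TensorProduct.map p.toLinearMap p.toLinearMap (comul x) :=
    fun x ↦ RingQuot.liftAlgHom_mkAlgHom_apply ..
  have hε' : ∀ x, ε (p x) = counit x := fun x ↦ RingQuot.liftAlgHom_mkAlgHom_apply ..
  have hS' : ∀ x, ((MulOpposite.opLinearEquiv R).symm.toLinearMap ∘ₗ S.toLinearMap) (p x) =
      p (antipode R x) :=
    fun x ↦ congrArg MulOpposite.unop (RingQuot.liftAlgHom_mkAlgHom_apply ..)
  exact ⟨hopfAlgStructOfSurjective p (RingQuot.mkAlgHom_surjective R _) Δ ε _ hΔ' hε' hS', hΔ', hε', hS'⟩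

end Quotient

/-- Let `H` be a Hopf algebra over `R`, free as an `R`-module, `A ⊆ H` a
Hopf subalgebra and `D ⊆ H` a left coideal subalgebra.  With
`K(A,D) = {x ∈ D : ad_h(x) ∈ D ∀ h ∈ A}`, the two-sided ideal `J` generated by
`K(A,D) ∩ ker ε` is a Hopf ideal (`Δ(J) ⊆ H ⊗ J + J ⊗ H`, `ε(J) = 0`, `S(J) ⊆ J`), and the
quotient `H/J` inherits a Hopf algebra structure over `R`. -/
theorem hopf_ideal_from_left_coideal_subalgebra
    (R : Type*) (H : Type*) [CommRing R] [Ring H] [HopfAlgebra R H]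
    [Module.Free R H]
    (A : Subalgebra R H)
    (hAcomul : ∀ a ∈ A, Coalgebra.comul (R := R) a ∈
      LinearMap.range (TensorProduct.map (Subalgebra.toSubmodule A).subtype
        (Subalgebra.toSubmodule A).subtype))
    (hAantipode : ∀ a ∈ A, HopfAlgebra.antipode (R := R) a ∈ A)
    (D : Subalgebra R H)
    (hD : ∀ d ∈ D, Coalgebra.comul (R := R) d ∈
      LinearMap.range (LinearMap.lTensor H (Subalgebra.toSubmodule D).subtype)) :
    (∀ x ∈ Jideal R H A D,
      Coalgebra.comul (R := R) x ∈
        LinearMap.range (LinearMap.lTensor H (Jideal R H A D).subtype) ⊔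
          LinearMap.range (LinearMap.rTensor H (Jideal R H A D).subtype)) ∧
    (∀ x ∈ Jideal R H A D, Coalgebra.counit (R := R) x = (0 : R)) ∧
    (∀ x ∈ Jideal R H A D, HopfAlgebra.antipode (R := R) x ∈ Jideal R H A D) ∧
    (∃ Hq : HopfAlgStruct R (RingQuot (quotRel R H A D)),
      (∀ x : H,
        Hq.comul (RingQuot.mkAlgHom R (quotRel R H A D) x) =
          (TensorProduct.map (RingQuot.mkAlgHom R (quotRel R H A D)).toLinearMap
            (RingQuot.mkAlgHom R (quotRel R H A D)).toLinearMap)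
            (Coalgebra.comul (R := R) x)) ∧
      (∀ x : H,
        Hq.counit (RingQuot.mkAlgHom R (quotRel R H A D) x) = Coalgebra.counit (R := R) x) ∧
      (∀ x : H,
        Hq.antipode (RingQuot.mkAlgHom R (quotRel R H A D) x) =
          RingQuot.mkAlgHom R (quotRel R H A D) (HopfAlgebra.antipode (R := R) x))) := by
  have hK : ∀ k ∈ Kset R H A D, comul (R := R) k ∈
      LinearMap.range (LinearMap.lTensor H (Ksubmodule R H A D).subtype) :=
    fun k hk ↦ comul_mem_of_mem_Ksubmodule hAcomul hD hk
  exact ⟨fun x hx ↦ comul_mem_twoSided_Jideal hK hx, fun x hx ↦ counit_eq_zero_of_mem_Jideal hx,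
    fun x hx ↦ antipode_mem_Jideal hK hx,
    exists_hopfAlgStruct_ringQuot (fun x hx ↦ comul_mem_twoSided_Jideal hK hx)
      fun x hx ↦ antipode_mem_Jideal hK hx⟩

end GeneralHopf
end
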